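/- For every searchable family of graphs over an alphabet Σ and every k ≥ 1, the family of graph languages accepted by nondeterministic k-head graph-walking automata with nested pebbles equals the family definable in first-order logic with positive occurrences of k-ary transitive closure: NPTWA^k = FO+posTC^k. -/

import Mathlib

namespace NestedPebblesGraphs

/-- A nonempty finite weakly connected directed graph with node and edge labels
from `Sig`, such that no node has two outgoing edges with the same label, nor two
incoming edges with the same label. -/
structure LGraph (Sig : Type) : Type 1 where
  V : Type
  finV : Fintype V
  neV : Nonempty V
  nlab : V → Sig
  edge : Sig → V → V → Prop
  out_unique : ∀ a u v v', edge a u v → edge a u v' → v = v'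
  in_unique : ∀ a u u' v, edge a u v → edge a u' v → u = u'
  conn : ∀ u v : V,
    Relation.ReflTransGen (fun x y => (∃ a, edge a x y) ∨ (∃ a, edge a y x)) u v

variable {Sig : Type}

/-!  ### First-order logic with k-ary transitive closure, on graphs  -/

/-- First-order formulas on graphs over `Sig`, with a `k`-ary transitive closure
operator.  `lab a x` means node `x` has label `a`; `edg a x y` means there is an
`a`-labelled edge from `x` to `y`; `tc xs ys φ us vs` is the transitive closure
`φ*` of `φ` with respect to the tuples of variables `xs`, `ys` (which it binds),
applied to the tuples of variables `us`, `vs`. -/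
inductive GForm (Sig : Type) (k : ℕ) : Type
  | lab (a : Sig) (x : ℕ)
  | edg (a : Sig) (x y : ℕ)
  | eq (x y : ℕ)
  | not (φ : GForm Sig k)
  | and (φ ψ : GForm Sig k)
  | or (φ ψ : GForm Sig k)
  | ex (x : ℕ) (φ : GForm Sig k)
  | all (x : ℕ) (φ : GForm Sig k)
  | tc (xs ys : Fin k → ℕ) (φ : GForm Sig k) (us vs : Fin k → ℕ)

/-- Update a valuation on a tuple of variables simultaneously. -/
noncomputable def updVec {α : Type} {k : ℕ} (ν : ℕ → α) (xs : Fin k → ℕ) (a : Fin k → α) :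
    ℕ → α :=
  fun n => if h : ∃ i, xs i = n then a h.choose else ν n

/-- Satisfaction of a formula in a graph `g` under a valuation of the variables. -/
def GSat {k : ℕ} (g : LGraph Sig) : GForm Sig k → (ℕ → g.V) → Prop
  | .lab a x, ν => g.nlab (ν x) = a
  | .edg a x y, ν => g.edge a (ν x) (ν y)
  | .eq x y, ν => ν x = ν y
  | .not φ, ν => ¬ GSat g φ ν
  | .and φ ψ, ν => GSat g φ ν ∧ GSat g ψ ν
  | .or φ ψ, ν => GSat g φ ν ∨ GSat g ψ ν
  | .ex x φ, ν => ∃ u : g.V, GSat g φ (Function.update ν x u)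
  | .all x φ, ν => ∀ u : g.V, GSat g φ (Function.update ν x u)
  | .tc xs ys φ us vs, ν =>
      Relation.ReflTransGen
        (fun a b : Fin k → g.V => GSat g φ (updVec (updVec ν xs a) ys b))
        (fun i => ν (us i)) (fun i => ν (vs i))

/-- The free variables of a formula. -/
def gfree {k : ℕ} : GForm Sig k → Set ℕ
  | .lab _ x => {x}
  | .edg _ x y => {x, y}
  | .eq x y => {x, y}
  | .not φ => gfree φ
  | .and φ ψ => gfree φ ∪ gfree ψ
  | .or φ ψ => gfree φ ∪ gfree ψ
  | .ex x φ => gfree φ \ {x}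
  | .all x φ => gfree φ \ {x}
  | .tc xs ys φ us vs =>
      (gfree φ \ (Set.range xs ∪ Set.range ys)) ∪ Set.range us ∪ Set.range vs

/-- Two `k`-tuples of variables consist of `2k` pairwise distinct variables. -/
def Distinct2 {k : ℕ} (xs ys : Fin k → ℕ) : Prop :=
  Function.Injective xs ∧ Function.Injective ys ∧ ∀ i j, xs i ≠ ys j

/-- `φ` is functional in the tuples of variables `xs`, `ys`. -/
def GFunctionalIn {k : ℕ} (φ : GForm Sig k) (xs ys : Fin k → ℕ) : Prop :=
  ∀ (g : LGraph Sig) (ν : ℕ → g.V) (a b b' : Fin k → g.V),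
    GSat g φ (updVec (updVec ν xs a) ys b) →
    GSat g φ (updVec (updVec ν xs a) ys b') → b = b'

/-- Well-formedness: in each transitive closure the `2k` bound variables are
pairwise distinct and occur free in the body. -/
def GWF {k : ℕ} : GForm Sig k → Prop
  | .not φ => GWF φ
  | .and φ ψ => GWF φ ∧ GWF ψ
  | .or φ ψ => GWF φ ∧ GWF ψ
  | .ex _ φ => GWF φ
  | .all _ φ => GWF φ
  | .tc xs ys φ _ _ =>
      Distinct2 xs ys ∧ (Set.range xs ∪ Set.range ys) ⊆ gfree φ ∧ GWF φ
  | _ => True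

/-- All transitive closures occurring in the formula are deterministic. -/
def GDetTC {k : ℕ} : GForm Sig k → Prop
  | .not φ => GDetTC φ
  | .and φ ψ => GDetTC φ ∧ GDetTC ψ
  | .or φ ψ => GDetTC φ ∧ GDetTC ψ
  | .ex _ φ => GDetTC φ
  | .all _ φ => GDetTC φ
  | .tc xs ys φ _ _ => GFunctionalIn φ xs ys ∧ GDetTC φ
  | _ => True

/-- All occurrences of transitive closure are positive. -/
def GPosTC {k : ℕ} : Bool → GForm Sig k → Prop
  | b, .not φ => GPosTC (!b) φ
  | b, .and φ ψ => GPosTC b φ ∧ GPosTC b ψ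
  | b, .or φ ψ => GPosTC b φ ∧ GPosTC b ψ
  | b, .ex _ φ => GPosTC b φ
  | b, .all _ φ => GPosTC b φ
  | b, .tc _ _ φ _ _ => b = true ∧ GPosTC b φ
  | _, _ => True

/-- The formula contains no transitive closure operator (pure first-order). -/
def GTCFree {k : ℕ} : GForm Sig k → Prop
  | .not φ => GTCFree φ
  | .and φ ψ => GTCFree φ ∧ GTCFree ψ
  | .or φ ψ => GTCFree φ ∧ GTCFree ψ
  | .ex _ φ => GTCFree φ
  | .all _ φ => GTCFree φ
  | .tc _ _ _ _ _ => False
  | _ => True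

/-- `FO+DTC^k` graph languages within the family `F`: those defined by closed
formulas with deterministic `k`-ary transitive closure. -/
def FODTCg (Sig : Type) (F : Set (LGraph Sig)) (k : ℕ) : Set (Set (LGraph Sig)) :=
  {L | ∃ φ : GForm Sig k, GWF φ ∧ GDetTC φ ∧ gfree φ = ∅ ∧
        L = {g | g ∈ F ∧ ∀ ν : ℕ → g.V, GSat g φ ν}}

/-- `FO+posTC^k` graph languages within the family `F`. -/
def FOposTCg (Sig : Type) (F : Set (LGraph Sig)) (k : ℕ) : Set (Set (LGraph Sig)) :=
  {L | ∃ φ : GForm Sig k, GWF φ ∧ GPosTC true φ ∧ gfree φ = ∅ ∧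
        L = {g | g ∈ F ∧ ∀ ν : ℕ → g.V, GSat g φ ν}}

/-!  ### k-head graph-walking automata with nested pebbles  -/

/-- Tests of a `k`-head graph-walking automaton with pebble set `X`. -/
inductive GTest (Sig : Type) (k : ℕ) (X : Type) : Type
  | lab (i : Fin k) (a : Sig)
  | inedge (i : Fin k) (a : Sig)
  | outedge (i : Fin k) (a : Sig)
  | peb (i : Fin k) (x : X)

/-- Instructions: move head `i` along an incoming or outgoing `a`-labelled edge,
drop a pebble at head `i`, retrieve the most recently dropped pebble (from a
distance), jump head `i` to the node holding pebble `x`, or perform a positive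
(`b = true`) or negated (`b = false`) test. -/
inductive GInstr (Sig : Type) (k : ℕ) (X : Type) : Type
  | inmove (i : Fin k) (a : Sig)
  | outmove (i : Fin k) (a : Sig)
  | dropPeb (i : Fin k) (x : X)
  | retrieve (x : X)
  | jump (i : Fin k) (x : X)
  | test (b : Bool) (τ : GTest Sig k X)

/-- A `k`-head graph-walking automaton with nested pebbles. -/
structure GWA (Sig : Type) (k : ℕ) : Type 1 where
  Q : Type
  finQ : Fintype Q
  X : Type
  finX : Fintype X
  q0 : Q
  acc : Set Q
  instr : Set (Q × GInstr Sig k X × Q)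
  instrFin : instr.Finite

/-- Configurations: a state, the positions of the `k` heads, and the stack of
dropped pebbles with their positions (most recent first). -/
abbrev GConf {k : ℕ} (A : GWA Sig k) (g : LGraph Sig) : Type :=
  A.Q × (Fin k → g.V) × List (A.X × g.V)

/-- Semantics of tests. -/
def gTestHolds {k : ℕ} (g : LGraph Sig) {X : Type} (τ : GTest Sig k X)
    (hs : Fin k → g.V) (π : List (X × g.V)) : Prop :=
  match τ with
  | .lab i a => g.nlab (hs i) = a
  | .inedge i a => ∃ u, g.edge a u (hs i)
  | .outedge i a => ∃ v, g.edge a (hs i) v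
  | .peb i x => (x, hs i) ∈ π

/-- Semantics of a single instruction. -/
def gInstrStep {k : ℕ} (g : LGraph Sig) {X : Type} (ins : GInstr Sig k X)
    (hs : Fin k → g.V) (π : List (X × g.V))
    (hs' : Fin k → g.V) (π' : List (X × g.V)) : Prop :=
  match ins with
  | .inmove i a => π' = π ∧ g.edge a (hs' i) (hs i) ∧ ∀ h, h ≠ i → hs' h = hs h
  | .outmove i a => π' = π ∧ g.edge a (hs i) (hs' i) ∧ ∀ h, h ≠ i → hs' h = hs h
  | .dropPeb i x => hs' = hs ∧ π' = (x, hs i) :: π ∧ ∀ w, (x, w) ∉ π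
  | .retrieve x => hs' = hs ∧ ∃ w, π = (x, w) :: π'
  | .jump i x => π' = π ∧ (x, hs' i) ∈ π ∧ ∀ h, h ≠ i → hs' h = hs h
  | .test b τ => hs' = hs ∧ π' = π ∧ (gTestHolds g τ hs π ↔ b = true)

/-- The step relation of automaton `A` on graph `g`. -/
def GStep {k : ℕ} (A : GWA Sig k) (g : LGraph Sig) : GConf A g → GConf A g → Prop :=
  fun c c' => ∃ ins : GInstr Sig k A.X,
    (c.1, ins, c'.1) ∈ A.instr ∧ gInstrStep g ins c.2.1 c.2.2 c'.2.1 c'.2.2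

/-- `χ'` is the negation of the test `χ`. -/
def gNegOf {k : ℕ} {X : Type} (χ χ' : GInstr Sig k X) : Prop :=
  ∃ b τ, χ = GInstr.test b τ ∧ χ' = GInstr.test (!b) τ

/-- Determinism: any two distinct instructions with the same source state consist
of a test and its negation. -/
def GDeterministic {k : ℕ} (A : GWA Sig k) : Prop :=
  ∀ p χ₁ q₁ χ₂ q₂, (p, χ₁, q₁) ∈ A.instr → (p, χ₂, q₂) ∈ A.instr →
    (χ₁, q₁) ≠ (χ₂, q₂) → gNegOf χ₁ χ₂ ∨ gNegOf χ₂ χ₁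

/-- A configuration is halting if no step is possible from it. -/
def GHaltingConf {k : ℕ} (A : GWA Sig k) (g : LGraph Sig) (c : GConf A g) : Prop :=
  ∀ c', ¬ GStep A g c c'

/-- There is an accepting computation started with all heads on node `u`:
it starts in the initial state with no pebbles, and halts in an accepting state
with no pebbles on the graph. -/
def AccFrom {k : ℕ} (A : GWA Sig k) (g : LGraph Sig) (u : g.V) : Prop :=
  ∃ (q : A.Q) (hs : Fin k → g.V), q ∈ A.acc ∧
    Relation.ReflTransGen (GStep A g) (A.q0, fun _ => u, []) (q, hs, []) ∧
    GHaltingConf A g (q, hs, [])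

/-- `A` accepts `g`: for every choice of initial node there is an accepting
computation. -/
def GAccepts {k : ℕ} (A : GWA Sig k) (g : LGraph Sig) : Prop :=
  ∀ u : g.V, AccFrom A g u

/-- The restriction on automata: acceptance is independent of the initial node. -/
def NodeIndependent {k : ℕ} (A : GWA Sig k) : Prop :=
  ∀ (g : LGraph Sig) (u₁ u₂ : g.V), AccFrom A g u₁ → AccFrom A g u₂

/-- The automaton uses no jump instructions (the basic model). -/
def NoJump {k : ℕ} (A : GWA Sig k) : Prop :=
  ∀ p χ q, (p, χ, q) ∈ A.instr → ∀ i x, χ ≠ GInstr.jump i x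

/-- `DPTWA^k` within the family `F`: graph languages accepted by deterministic
`k`-head graph-walking automata with nested pebbles (no jump instructions). -/
def DPTWAg (Sig : Type) (F : Set (LGraph Sig)) (k : ℕ) : Set (Set (LGraph Sig)) :=
  {L | ∃ A : GWA Sig k, GDeterministic A ∧ NoJump A ∧ NodeIndependent A ∧
        L = {g | g ∈ F ∧ GAccepts A g}}

/-- `DPTWA^k` within the family `F`, for the model extended with jump
instructions. -/
def DPTWAgJ (Sig : Type) (F : Set (LGraph Sig)) (k : ℕ) : Set (Set (LGraph Sig)) :=
  {L | ∃ A : GWA Sig k, GDeterministic A ∧ NodeIndependent A ∧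
        L = {g | g ∈ F ∧ GAccepts A g}}

/-- `NPTWA^k` within the family `F`: graph languages accepted by nondeterministic
`k`-head graph-walking automata with nested pebbles (no jump instructions). -/
def NPTWAg (Sig : Type) (F : Set (LGraph Sig)) (k : ℕ) : Set (Set (LGraph Sig)) :=
  {L | ∃ A : GWA Sig k, NoJump A ∧ NodeIndependent A ∧
        L = {g | g ∈ F ∧ GAccepts A g}}

/-- Started with all heads on node `u` of `g`, the (deterministic) automaton `A`
performs a walk that halts and during which every node of `g` is visited by some
head at least once. -/
def SearchesFrom {k : ℕ} (A : GWA Sig k) (g : LGraph Sig) (u : g.V) : Prop :=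
  ∃ (n : ℕ) (cs : Fin (n + 1) → GConf A g),
    cs 0 = (A.q0, fun _ => u, []) ∧
    (∀ i : Fin n, GStep A g (cs i.castSucc) (cs i.succ)) ∧
    GHaltingConf A g (cs (Fin.last n)) ∧
    ∀ v : g.V, ∃ (i : Fin (n + 1)) (h : Fin k), (cs i).2.1 h = v

/-- A family of graphs is `k`-searchable if some fixed deterministic `k`-head
graph-walking automaton with nested pebbles (a guide) traverses every graph of the
family from every initial node, visiting all nodes and halting. -/
def kSearchable (Sig : Type) (F : Set (LGraph Sig)) (k : ℕ) : Prop :=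
  ∃ A : GWA Sig k, GDeterministic A ∧ NoJump A ∧
    ∀ g ∈ F, ∀ u : g.V, SearchesFrom A g u

/-- A family of graphs is searchable if it is `1`-searchable, i.e., some fixed
single-head deterministic graph-walking automaton with nested pebbles traverses
every graph of the family. -/
def Searchable (Sig : Type) (F : Set (LGraph Sig)) : Prop :=
  kSearchable Sig F 1

/-- Replacing the node labels of a graph. -/
def relabel (g : LGraph Sig) (f : g.V → Sig) : LGraph Sig :=
  { g with nlab := f }

/-- Membership in the family does not depend on the node labels. -/
def NodeLabelInsensitive (F : Set (LGraph Sig)) : Prop :=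
  ∀ g ∈ F, ∀ f : g.V → Sig, relabel g f ∈ F

end NestedPebblesGraphs

namespace NestedPebblesGraphs

open Relation

/-! ### Part A: state elimination -/

section Kleene
variable {I : Type*} {α : I → Type*}

/-- Relation families. -/
abbrev RelF (α : I → Type*) := ∀ i, α i → α i → Prop

/-- Paths with intermediate states in the list. -/
def kPath {Q : Type*} (S : Q → Q → RelF α) : List Q → Q → Q → RelF α
  | [] => S
  | r :: W => fun p q i a b => kPath S W p q i a b ∨
      ∃ c, kPath S W p r i a c ∧ ∃ d, ReflTransGen (kPath S W r r i) c d ∧ kPath S W r q i d b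

theorem kPath_trans {Q : Type*} (S : Q → Q → RelF α) (W : List Q) :
    ∀ (r : Q), r ∈ W → ∀ (p q : Q) i a b c, kPath S W p r i a b → kPath S W r q i b c →
      kPath S W p q i a c := by
  induction W with
  | nil => intro r hr; simp at hr
  | cons r0 W ih =>
    intro r hr p q i a b c h1 h2
    rcases List.mem_cons.1 hr with rfl | hr
    · have h1' : ∃ d, kPath S W p r i a d ∧ ReflTransGen (kPath S W r r i) d b := by
        rcases h1 with h1 | ⟨d, hd, e, he, hf⟩
        · exact ⟨b, h1, .refl⟩
        · exact ⟨d, hd, he.tail hf⟩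
      have h2' : ∃ d, ReflTransGen (kPath S W r r i) b d ∧ kPath S W r q i d c := by
        rcases h2 with h2 | ⟨d, hd, e, he, hf⟩
        · exact ⟨b, .refl, h2⟩
        · exact ⟨e, ReflTransGen.head hd he, hf⟩
      obtain ⟨d, hd, hd'⟩ := h1'
      obtain ⟨e, he, he'⟩ := h2'
      exact Or.inr ⟨d, hd, e, hd'.trans he, he'⟩
    · have ih := ih r hr
      rcases h1 with h1 | ⟨d, hd, e, he, hf⟩ <;> rcases h2 with h2 | ⟨d', hd', e', he', hf'⟩
      · exact Or.inl (ih _ _ _ _ _ _ h1 h2)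
      · exact Or.inr ⟨d', ih _ _ _ _ _ _ h1 hd', e', he', hf'⟩
      · exact Or.inr ⟨d, hd, e, he, ih _ _ _ _ _ _ hf h2⟩
      · exact Or.inr ⟨d, hd, e', (he.tail (ih _ _ _ _ _ _ hf hd')).trans he', hf'⟩

theorem kPath_base {Q : Type*} (S : Q → Q → RelF α) (W : List Q) (p q : Q) (i a b)
    (h : S p q i a b) : kPath S W p q i a b := by
  induction W with
  | nil => exact h
  | cons r W ih => exact Or.inl ih

theorem kPath_sound {Q : Type*} (S : Q → Q → RelF α) (W : List Q) :
    ∀ (p q : Q) i a b, kPath S W p q i a b →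
    ReflTransGen (fun x y : Q × α i => S x.1 y.1 i x.2 y.2) (p, a) (q, b) := by
  induction W with
  | nil => intro p q i a b h; exact .single h
  | cons r W ih =>
    intro p q i a b h
    rcases h with h | ⟨c, hc, d, hd, he⟩
    · exact ih _ _ _ _ _ h
    · refine (ih _ _ _ _ _ hc).trans (.trans ?_ (ih _ _ _ _ _ he))
      clear hc he
      induction hd with
      | refl => exact .refl
      | tail _ h ih2 => exact ih2.trans (ih _ _ _ _ _ h)

theorem kleene (C : RelF α → Prop)
    (hbot : C (fun _ _ _ => False))
    (hor : ∀ R S, C R → C S → C (fun i a b => R i a b ∨ S i a b))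
    (hcomp : ∀ R S, C R → C S → C (fun i a b => ∃ c, R i a c ∧ S i c b))
    (hstar : ∀ R, C R → C (fun i a b => ReflTransGen (R i) a b))
    {Q : Type*} [Finite Q] (S : Q → Q → RelF α) (hS : ∀ p q, C (S p q)) (p q : Q) :
    C (fun i a b => ReflTransGen (fun x y : Q × α i => S x.1 y.1 i x.2 y.2) (p, a) (q, b)) := by
  classical
  have _ := Fintype.ofFinite Q
  have hk : ∀ W p q, C (kPath S W p q) := by
    intro W
    induction W with
    | nil => exact hS
    | cons r W ih =>
      intro p q
      exact hor _ _ (ih p q) (hcomp _ _ (ih p r) (hcomp _ _ (hstar _ (ih r r)) (ih r q)))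
  have hid : C (fun i a b => p = q ∧ a = b) := by
    by_cases h : p = q
    · have := hstar _ hbot
      convert this using 4 with i a b
      simp only [h, true_and]
      constructor
      · rintro rfl; exact .refl
      · intro h
        induction h with
        | refl => rfl
        | tail _ h => exact h.elim
    · convert hbot using 4
      simp [h]
  convert hor _ _ hid (hk Finset.univ.toList p q) using 4 with i a b
  constructor
  · intro h
    have key : ∀ y : Q × α i,
      ReflTransGen (fun x y : Q × α i => S x.1 y.1 i x.2 y.2) (p, a) y →
      (p = y.1 ∧ a = y.2) ∨ kPath S Finset.univ.toList p y.1 i a y.2 := by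
      intro y hy
      induction hy with
      | refl => exact Or.inl ⟨rfl, rfl⟩
      | @tail y z _ h ih =>
        right
        rcases ih with ⟨h1, h2⟩ | ih
        · refine kPath_base _ _ _ _ _ _ _ ?_
          rw [h1, h2]; exact h
        · exact kPath_trans S _ y.1 (by simp) _ _ _ _ _ _ ih (kPath_base _ _ _ _ _ _ _ h)
    exact key _ h
  · rintro (⟨rfl, rfl⟩ | h)
    · exact .refl
    · exact kPath_sound _ _ _ _ _ _ _ h

/-- Finite unions. -/
theorem clos_iUnion (C : RelF α → Prop)
    (hbot : C (fun _ _ _ => False))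
    (hor : ∀ R S, C R → C S → C (fun i a b => R i a b ∨ S i a b))
    {J : Type*} [Finite J] (R : J → RelF α) (hR : ∀ j, C (R j)) :
    C (fun i a b => ∃ j, R j i a b) := by
  classical
  have _ := Fintype.ofFinite J
  have : ∀ l : List J, C (fun i a b => ∃ j ∈ l, R j i a b) := by
    intro l
    induction l with
    | nil => simpa using hbot
    | cons j l ih => simpa using hor _ _ (hR j) ih
  simpa using this Finset.univ.toList

end Kleene

/-! ### Part B: regular programs and finite automata -/

section Frag
variable {I : Type*} {α : I → Type*} {Ins : Type}

/-- Relations generated from instructions by the regular operations. -/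
inductive IsProg (sem : Ins → RelF α) : RelF α → Prop
  | ins (x : Ins) : IsProg sem (sem x)
  | bot : IsProg sem (fun _ _ _ => False)
  | or (R S : RelF α) : IsProg sem R → IsProg sem S →
      IsProg sem (fun i a b => R i a b ∨ S i a b)
  | comp (R S : RelF α) : IsProg sem R → IsProg sem S →
      IsProg sem (fun i a b => ∃ c, R i a c ∧ S i c b)
  | star (R : RelF α) : IsProg sem R → IsProg sem (fun i a b => ReflTransGen (R i) a b)

/-- Semantics of optional instructions. -/
def optSem (sem : Ins → RelF α) : Option Ins → RelF α
  | none => fun _ a b => a = b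
  | some x => sem x

/-- Step relation of a transition table. -/
def fStep (sem : Ins → RelF α) {Q : Type} (T : Set (Q × Option Ins × Q)) (i : I) :
    Q × α i → Q × α i → Prop :=
  fun x y => ∃ o, (x.1, o, y.1) ∈ T ∧ optSem sem o i x.2 y.2

theorem fStep_lift (sem : Ins → RelF α) {Q Q' : Type} (T : Set (Q × Option Ins × Q))
    (T' : Set (Q' × Option Ins × Q')) (f : Q → Q')
    (hf : ∀ p o q, (p, o, q) ∈ T → (f p, o, f q) ∈ T') (i : I) (p q : Q) (a b : α i)
    (h : ReflTransGen (fStep sem T i) (p, a) (q, b)) :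
    ReflTransGen (fStep sem T' i) (f p, a) (f q, b) := by
  have key : ∀ y, ReflTransGen (fStep sem T i) (p, a) y →
      ReflTransGen (fStep sem T' i) (f p, a) (f y.1, y.2) := by
    intro y hy
    induction hy with
    | refl => exact .refl
    | tail _ h ih =>
      obtain ⟨o, h1, h2⟩ := h
      exact ih.tail ⟨o, hf _ _ _ h1, h2⟩
  exact key _ h

/-- `R` is realised by a finite transition table. -/
def Realised (sem : Ins → RelF α) (R : RelF α) : Prop :=
  ∃ (Q : Type) (_ : Finite Q) (T : Set (Q × Option Ins × Q)) (s t : Q),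
    (∀ o q, (t, o, q) ∉ T) ∧
    ∀ i a b, R i a b ↔ ReflTransGen (fStep sem T i) (s, a) (t, b)

theorem Realised.ins (sem : Ins → RelF α) (x : Ins) : Realised sem (sem x) := by
  refine ⟨Bool, inferInstance, {(false, some x, true)}, false, true, by simp, ?_⟩
  intro i a b
  constructor
  · intro h
    exact .single ⟨some x, rfl, h⟩
  · intro h
    have key : ∀ y : Bool × α i,
        ReflTransGen (fStep sem {(false, some x, true)} i) (false, a) y →
        (y.1 = false ∧ y.2 = a) ∨ (y.1 = true ∧ sem x i a y.2) := by
      intro y hy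
      induction hy with
      | refl => simp
      | @tail y z _ h ih =>
        obtain ⟨o, h1, h2⟩ := h
        simp only [Set.mem_singleton_iff, Prod.mk.injEq] at h1
        obtain ⟨h1, rfl, h3⟩ := h1
        rcases ih with ⟨_, ih⟩ | ⟨ih, _⟩
        · right; refine ⟨h3, ?_⟩; rw [← ih]; exact h2
        · simp [ih] at h1
    simpa using key _ h

theorem Realised.bot (sem : Ins → RelF α) : Realised sem (fun _ _ _ => False) := by
  refine ⟨Bool, inferInstance, ∅, false, true, by simp, ?_⟩
  intro i a b
  simp only [false_iff]
  intro h
  rcases ReflTransGen.cases_head h with h | ⟨c, ⟨o, h, _⟩, _⟩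
  · simp at h
  · exact h

theorem Realised.comp (sem : Ins → RelF α) (R S : RelF α) (hR : Realised sem R)
    (hS : Realised sem S) : Realised sem (fun i a b => ∃ c, R i a c ∧ S i c b) := by
  obtain ⟨Q1, _, T1, s1, t1, ht1, h1⟩ := hR
  obtain ⟨Q2, _, T2, s2, t2, ht2, h2⟩ := hS
  let T : Set ((Q1 ⊕ Q2) × Option Ins × (Q1 ⊕ Q2)) := {x | match x with
    | (.inl p, o, .inl q) => (p, o, q) ∈ T1
    | (.inr p, o, .inr q) => (p, o, q) ∈ T2
    | (.inl p, o, .inr q) => p = t1 ∧ q = s2 ∧ o = none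
    | _ => False}
  refine ⟨Q1 ⊕ Q2, inferInstance, T, .inl s1, .inr t2, ?_, ?_⟩
  · rintro o (q | q) h
    · exact h
    · exact ht2 o q h
  intro i a b
  constructor
  · rintro ⟨c, hc, hd⟩
    refine (fStep_lift sem T1 T Sum.inl (fun _ _ _ h => h) i _ _ _ _ ((h1 _ _ _).1 hc)).trans ?_
    refine ReflTransGen.head ?_
      (fStep_lift sem T2 T Sum.inr (fun _ _ _ h => h) i _ _ _ _ ((h2 _ _ _).1 hd))
    exact ⟨none, ⟨rfl, rfl, rfl⟩, rfl⟩
  · intro h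
    have key : ∀ y : (Q1 ⊕ Q2) × α i, ReflTransGen (fStep sem T i) (.inl s1, a) y →
        (∃ q, y.1 = .inl q ∧ ReflTransGen (fStep sem T1 i) (s1, a) (q, y.2)) ∨
        (∃ q, y.1 = .inr q ∧ ∃ c, R i a c ∧ ReflTransGen (fStep sem T2 i) (s2, c) (q, y.2)) := by
      intro y hy
      induction hy with
      | refl => exact Or.inl ⟨s1, rfl, .refl⟩
      | @tail y z _ h ih =>
        obtain ⟨y1, y2⟩ := y
        obtain ⟨z1, z2⟩ := z
        obtain ⟨o, h3, h4⟩ := h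
        rcases ih with ⟨q, rfl, ih⟩ | ⟨q, rfl, c, hc, ih⟩
        · rcases z1 with q' | q'
          · exact Or.inl ⟨q', rfl, ih.tail ⟨o, h3, h4⟩⟩
          · obtain ⟨rfl, rfl, rfl⟩ := h3
            obtain rfl : y2 = z2 := h4
            exact Or.inr ⟨_, rfl, y2, (h1 _ _ _).2 ih, .refl⟩
        · rcases z1 with q' | q'
          · exact h3.elim
          · exact Or.inr ⟨q', rfl, c, hc, ih.tail ⟨o, h3, h4⟩⟩
    rcases key _ h with ⟨q, hq, _⟩ | ⟨q, hq, c, hc, h⟩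
    · simp at hq
    · obtain rfl := Sum.inr.inj hq
      exact ⟨c, hc, (h2 _ _ _).2 h⟩

theorem Realised.or (sem : Ins → RelF α) (R S : RelF α) (hR : Realised sem R)
    (hS : Realised sem S) : Realised sem (fun i a b => R i a b ∨ S i a b) := by
  obtain ⟨Q1, _, T1, s1, t1, ht1, h1⟩ := hR
  obtain ⟨Q2, _, T2, s2, t2, ht2, h2⟩ := hS
  let T : Set ((Bool ⊕ Q1 ⊕ Q2) × Option Ins × (Bool ⊕ Q1 ⊕ Q2)) := {x | match x with
    | (.inr (.inl p), o, .inr (.inl q)) => (p, o, q) ∈ T1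
    | (.inr (.inr p), o, .inr (.inr q)) => (p, o, q) ∈ T2
    | (.inl x, o, .inr (.inl q)) => x = false ∧ o = none ∧ q = s1
    | (.inl x, o, .inr (.inr q)) => x = false ∧ o = none ∧ q = s2
    | (.inr (.inl p), o, .inl x) => x = true ∧ o = none ∧ p = t1
    | (.inr (.inr p), o, .inl x) => x = true ∧ o = none ∧ p = t2
    | _ => False}
  refine ⟨Bool ⊕ Q1 ⊕ Q2, inferInstance, T, .inl false, .inl true, ?_, ?_⟩
  · rintro o (q | q | q) h
    · exact h
    · exact absurd h.1 (by simp)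
    · exact absurd h.1 (by simp)
  intro i a b
  constructor
  · rintro (hc | hc)
    · refine ReflTransGen.head (b := ((.inr (.inl s1) : Bool ⊕ Q1 ⊕ Q2), a)) ⟨none, ⟨rfl, rfl, rfl⟩, rfl⟩ ?_
      exact (fStep_lift sem T1 T (Sum.inr ∘ Sum.inl) (fun _ _ _ h => h) i _ _ _ _
        ((h1 _ _ _).1 hc)).tail ⟨none, ⟨rfl, rfl, rfl⟩, rfl⟩
    · refine ReflTransGen.head (b := ((.inr (.inr s2) : Bool ⊕ Q1 ⊕ Q2), a)) ⟨none, ⟨rfl, rfl, rfl⟩, rfl⟩ ?_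
      exact (fStep_lift sem T2 T (Sum.inr ∘ Sum.inr) (fun _ _ _ h => h) i _ _ _ _
        ((h2 _ _ _).1 hc)).tail ⟨none, ⟨rfl, rfl, rfl⟩, rfl⟩
  · intro h
    have key : ∀ y : (Bool ⊕ Q1 ⊕ Q2) × α i, ReflTransGen (fStep sem T i) (.inl false, a) y →
        (y.1 = .inl false ∧ y.2 = a) ∨ (y.1 = .inl true ∧ (R i a y.2 ∨ S i a y.2)) ∨
        (∃ q, y.1 = .inr (.inl q) ∧ ReflTransGen (fStep sem T1 i) (s1, a) (q, y.2)) ∨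
        (∃ q, y.1 = .inr (.inr q) ∧ ReflTransGen (fStep sem T2 i) (s2, a) (q, y.2)) := by
      intro y hy
      induction hy with
      | refl => exact Or.inl ⟨rfl, rfl⟩
      | @tail y z _ h ih =>
        obtain ⟨y1, y2⟩ := y
        obtain ⟨z1, z2⟩ := z
        obtain ⟨o, h3, h4⟩ := h
        rcases ih with ⟨rfl, rfl⟩ | ⟨rfl, ih⟩ | ⟨q, rfl, ih⟩ | ⟨q, rfl, ih⟩
        · rcases z1 with q' | q' | q'
          · exact h3.elim
          · obtain ⟨_, rfl, rfl⟩ := h3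
            obtain rfl : y2 = z2 := h4
            exact Or.inr (Or.inr (Or.inl ⟨_, rfl, .refl⟩))
          · obtain ⟨_, rfl, rfl⟩ := h3
            obtain rfl : y2 = z2 := h4
            exact Or.inr (Or.inr (Or.inr ⟨_, rfl, .refl⟩))
        · rcases z1 with q' | q' | q'
          · exact h3.elim
          · exact absurd h3.1 (by simp)
          · exact absurd h3.1 (by simp)
        · rcases z1 with q' | q' | q'
          · obtain ⟨rfl, rfl, rfl⟩ := h3
            obtain rfl : y2 = z2 := h4
            exact Or.inr (Or.inl ⟨rfl, Or.inl ((h1 _ _ _).2 ih)⟩)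
          · exact Or.inr (Or.inr (Or.inl ⟨_, rfl, ih.tail ⟨o, h3, h4⟩⟩))
          · exact h3.elim
        · rcases z1 with q' | q' | q'
          · obtain ⟨rfl, rfl, rfl⟩ := h3
            obtain rfl : y2 = z2 := h4
            exact Or.inr (Or.inl ⟨rfl, Or.inr ((h2 _ _ _).2 ih)⟩)
          · exact h3.elim
          · exact Or.inr (Or.inr (Or.inr ⟨_, rfl, ih.tail ⟨o, h3, h4⟩⟩))
    simpa using key _ h

theorem Realised.star (sem : Ins → RelF α) (R : RelF α) (hR : Realised sem R) :
    Realised sem (fun i a b => ReflTransGen (R i) a b) := by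
  obtain ⟨Q1, _, T1, s1, t1, ht1, h1⟩ := hR
  let T : Set ((Bool ⊕ Q1) × Option Ins × (Bool ⊕ Q1)) := {x | match x with
    | (.inr p, o, .inr q) => (p, o, q) ∈ T1
    | (.inl x, o, .inr q) => x = false ∧ o = none ∧ q = s1
    | (.inr p, o, .inl x) => x = false ∧ o = none ∧ p = t1
    | (.inl x, o, .inl y) => x = false ∧ o = none ∧ y = true}
  refine ⟨Bool ⊕ Q1, inferInstance, T, .inl false, .inl true, ?_, ?_⟩
  · rintro o (q | q) h
    · exact absurd h.1 (by simp)
    · exact absurd h.1 (by simp)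
  intro i a b
  constructor
  · intro h
    have : ReflTransGen (fStep sem T i) (.inl false, a) (.inl false, b) := by
      induction h with
      | refl => exact .refl
      | @tail c d _ h ih =>
        refine ih.trans ?_
        refine ReflTransGen.head (b := ((.inr s1 : Bool ⊕ Q1), c)) ⟨none, ⟨rfl, rfl, rfl⟩, rfl⟩ ?_
        exact (fStep_lift sem T1 T Sum.inr (fun _ _ _ h => h) i _ _ _ _
          ((h1 _ _ _).1 h)).tail ⟨none, ⟨rfl, rfl, rfl⟩, rfl⟩
    exact this.tail ⟨none, ⟨rfl, rfl, rfl⟩, rfl⟩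
  · intro h
    have key : ∀ y : (Bool ⊕ Q1) × α i, ReflTransGen (fStep sem T i) (.inl false, a) y →
        ((∃ x, y.1 = .inl x) ∧ ReflTransGen (R i) a y.2) ∨
        (∃ q, y.1 = .inr q ∧ ∃ c, ReflTransGen (R i) a c ∧
          ReflTransGen (fStep sem T1 i) (s1, c) (q, y.2)) := by
      intro y hy
      induction hy with
      | refl => exact Or.inl ⟨⟨_, rfl⟩, .refl⟩
      | @tail y z _ h ih =>
        obtain ⟨y1, y2⟩ := y
        obtain ⟨z1, z2⟩ := z
        obtain ⟨o, h3, h4⟩ := h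
        rcases ih with ⟨⟨x, rfl⟩, ih⟩ | ⟨q, rfl, c, hc, ih⟩
        · rcases z1 with q' | q'
          · obtain ⟨_, rfl, rfl⟩ := h3
            obtain rfl : y2 = z2 := h4
            exact Or.inl ⟨⟨_, rfl⟩, ih⟩
          · obtain ⟨_, rfl, rfl⟩ := h3
            obtain rfl : y2 = z2 := h4
            exact Or.inr ⟨_, rfl, _, ih, .refl⟩
        · rcases z1 with q' | q'
          · obtain ⟨_, rfl, rfl⟩ := h3
            obtain rfl : y2 = z2 := h4
            exact Or.inl ⟨⟨_, rfl⟩, hc.tail ((h1 _ _ _).2 ih)⟩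
          · exact Or.inr ⟨_, rfl, c, hc, ih.tail ⟨o, h3, h4⟩⟩
    simpa using key _ h

theorem IsProg.realised (sem : Ins → RelF α) (R : RelF α) (h : IsProg sem R) :
    Realised sem R := by
  induction h with
  | ins x => exact .ins sem x
  | bot => exact .bot sem
  | or R S _ _ h1 h2 => exact .or sem R S h1 h2
  | comp R S _ _ h1 h2 => exact .comp sem R S h1 h2
  | star R _ h => exact .star sem R h

end Frag
end NestedPebblesGraphs

namespace NestedPebblesGraphs

open Relation

variable {Sig : Type}

/-! ### Part C: definable relations -/

theorem updVec_apply {α : Type} {k : ℕ} (ν : ℕ → α) (xs : Fin k → ℕ) (a : Fin k → α)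
    (hx : Function.Injective xs) (i : Fin k) : updVec ν xs a (xs i) = a i := by
  unfold updVec
  have h : ∃ j, xs j = xs i := ⟨i, rfl⟩
  rw [dif_pos h]
  exact congrArg a (hx h.choose_spec)

theorem updVec_of_not {α : Type} {k : ℕ} (ν : ℕ → α) (xs : Fin k → ℕ) (a : Fin k → α)
    (n : ℕ) (h : ∀ i, xs i ≠ n) : updVec ν xs a n = ν n := by
  unfold updVec
  rw [dif_neg]
  rintro ⟨i, hi⟩
  exact h i hi

/-- Definability of a relation on nodes, with variables indexed by `ι`. -/
def Dfn (k : ℕ) (B : Set Bool) {ι : Type} (R : ∀ g : LGraph Sig, (ι → g.V) → Prop) : Prop :=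
  ∀ e : ι → ℕ, ∃ φ : GForm Sig k, GWF φ ∧ (∀ b ∈ B, GPosTC b φ) ∧ gfree φ ⊆ Set.range e ∧
    ∀ (g : LGraph Sig) (ν : ℕ → g.V), GSat g φ ν ↔ R g (fun i => ν (e i))

namespace Dfn
variable {k : ℕ} {B : Set Bool} {ι κ : Type}

theorem congr {R S : ∀ g : LGraph Sig, (ι → g.V) → Prop} (h : Dfn k B R)
    (hRS : ∀ g v, S g v ↔ R g v) : Dfn k B S := by
  intro e
  obtain ⟨φ, h1, h2, h3, h4⟩ := h e
  exact ⟨φ, h1, h2, h3, fun g ν => (h4 g ν).trans (hRS _ _).symm⟩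

theorem mono {B' : Set Bool} (hB : B' ⊆ B) {R : ∀ g : LGraph Sig, (ι → g.V) → Prop}
    (h : Dfn k B R) : Dfn k B' R := by
  intro e
  obtain ⟨φ, h1, h2, h3, h4⟩ := h e
  exact ⟨φ, h1, fun b hb => h2 b (hB hb), h3, h4⟩

theorem subst {R : ∀ g : LGraph Sig, (ι → g.V) → Prop} (h : Dfn k B R) (f : ι → κ) :
    Dfn k B (fun g (v : κ → g.V) => R g (fun i => v (f i))) := by
  intro e
  obtain ⟨φ, h1, h2, h3, h4⟩ := h (fun i => e (f i))
  refine ⟨φ, h1, h2, h3.trans ?_, h4⟩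
  rintro _ ⟨i, rfl⟩
  exact ⟨f i, rfl⟩

theorem lab (a : Sig) (i : ι) : Dfn k B (fun g v => g.nlab (v i) = a) := by
  intro e
  refine ⟨.lab a (e i), trivial, fun _ _ => trivial, ?_, fun g ν => Iff.rfl⟩
  simp [gfree]

theorem edg (a : Sig) (i j : ι) : Dfn k B (fun g v => g.edge a (v i) (v j)) := by
  intro e
  refine ⟨.edg a (e i) (e j), trivial, fun _ _ => trivial, ?_, fun g ν => Iff.rfl⟩
  simp [gfree, Set.insert_subset_iff]

theorem eq (i j : ι) : Dfn (Sig := Sig) k B (fun _ v => v i = v j) := by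
  intro e
  refine ⟨.eq (e i) (e j), trivial, fun _ _ => trivial, ?_, fun g ν => Iff.rfl⟩
  simp [gfree, Set.insert_subset_iff]

theorem not {R : ∀ g : LGraph Sig, (ι → g.V) → Prop} (h : Dfn k Set.univ R) :
    Dfn k B (fun g v => ¬ R g v) := by
  intro e
  obtain ⟨φ, h1, h2, h3, h4⟩ := h e
  exact ⟨.not φ, h1, fun b _ => h2 (!b) trivial, h3, fun g ν => not_congr (h4 g ν)⟩

theorem and {R S : ∀ g : LGraph Sig, (ι → g.V) → Prop} (h : Dfn k B R) (h' : Dfn k B S) :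
    Dfn k B (fun g v => R g v ∧ S g v) := by
  intro e
  obtain ⟨φ, h1, h2, h3, h4⟩ := h e
  obtain ⟨φ', h1', h2', h3', h4'⟩ := h' e
  exact ⟨.and φ φ', ⟨h1, h1'⟩, fun b hb => ⟨h2 b hb, h2' b hb⟩, Set.union_subset h3 h3',
    fun g ν => and_congr (h4 g ν) (h4' g ν)⟩

theorem or {R S : ∀ g : LGraph Sig, (ι → g.V) → Prop} (h : Dfn k B R) (h' : Dfn k B S) :
    Dfn k B (fun g v => R g v ∨ S g v) := by
  intro e
  obtain ⟨φ, h1, h2, h3, h4⟩ := h e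
  obtain ⟨φ', h1', h2', h3', h4'⟩ := h' e
  exact ⟨.or φ φ', ⟨h1, h1'⟩, fun b hb => ⟨h2 b hb, h2' b hb⟩, Set.union_subset h3 h3',
    fun g ν => or_congr (h4 g ν) (h4' g ν)⟩

theorem tru : Dfn (Sig := Sig) (ι := ι) k B (fun _ _ => True) := by
  intro e
  refine ⟨.ex 0 (.eq 0 0), trivial, fun _ _ => trivial, by simp [gfree], fun g ν => ?_⟩
  simpa [GSat] using g.neV

theorem const (P : Prop) : Dfn (Sig := Sig) (ι := ι) k B (fun _ _ => P) := by
  by_cases h : P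
  · exact tru.congr (by simp [h])
  · exact (Dfn.not tru).congr (by simp [h])

theorem exists_bound [Finite ι] (e : ι → ℕ) : ∃ M, ∀ i, e i < M := by
  obtain ⟨M, hM⟩ := (Set.finite_range e).bddAbove
  exact ⟨M + 1, fun i => Nat.lt_succ_of_le (hM ⟨i, rfl⟩)⟩

theorem ex [Finite ι] {R : ∀ g : LGraph Sig, (Option ι → g.V) → Prop} (h : Dfn k B R) :
    Dfn k B (fun g v => ∃ u, R g (fun o => o.elim u v)) := by
  intro e
  obtain ⟨M, hM⟩ := exists_bound e
  obtain ⟨φ, h1, h2, h3, h4⟩ := h (fun o => o.elim M e)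
  refine ⟨.ex M φ, h1, h2, ?_, fun g ν => ?_⟩
  · rintro n ⟨hn, hn'⟩
    obtain ⟨o, rfl⟩ := h3 hn
    cases o with
    | none => exact absurd rfl hn'
    | some i => exact ⟨i, rfl⟩
  · refine exists_congr fun u => (h4 g _).trans (iff_of_eq (congrArg _ ?_))
    funext o
    cases o with
    | none => simp
    | some i => simp [(hM i).ne]

theorem all [Finite ι] {R : ∀ g : LGraph Sig, (Option ι → g.V) → Prop} (h : Dfn k B R) :
    Dfn k B (fun g v => ∀ u, R g (fun o => o.elim u v)) := by
  intro e
  obtain ⟨M, hM⟩ := exists_bound e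
  obtain ⟨φ, h1, h2, h3, h4⟩ := h (fun o => o.elim M e)
  refine ⟨.all M φ, h1, h2, ?_, fun g ν => ?_⟩
  · rintro n ⟨hn, hn'⟩
    obtain ⟨o, rfl⟩ := h3 hn
    cases o with
    | none => exact absurd rfl hn'
    | some i => exact ⟨i, rfl⟩
  · refine forall_congr' fun u => (h4 g _).trans (iff_of_eq (congrArg _ ?_))
    funext o
    cases o with
    | none => simp
    | some i => simp [(hM i).ne]

theorem iex {J : Type*} [Finite J] {R : J → ∀ g : LGraph Sig, (ι → g.V) → Prop}
    (h : ∀ j, Dfn k B (R j)) : Dfn k B (fun g v => ∃ j, R j g v) := by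
  classical
  have _ := Fintype.ofFinite J
  have : ∀ l : List J, Dfn k B (fun g v => ∃ j ∈ l, R j g v) := by
    intro l
    induction l with
    | nil => exact (const False).congr (by simp)
    | cons j l ih => exact ((h j).or ih).congr (by simp)
  exact (this Finset.univ.toList).congr (by simp)

theorem iall {J : Type*} [Finite J] {R : J → ∀ g : LGraph Sig, (ι → g.V) → Prop}
    (h : ∀ j, Dfn k B (R j)) : Dfn k B (fun g v => ∀ j, R j g v) := by
  classical
  have _ := Fintype.ofFinite J
  have : ∀ l : List J, Dfn k B (fun g v => ∀ j ∈ l, R j g v) := by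
    intro l
    induction l with
    | nil => exact (const True).congr (by simp)
    | cons j l ih => exact ((h j).and ih).congr (by simp)
  exact (this Finset.univ.toList).congr (by simp)

theorem exVec [Finite ι] (m : ℕ) : ∀ {R : ∀ g : LGraph Sig, (ι ⊕ Fin m → g.V) → Prop},
    Dfn k B R → Dfn k B (fun g v => ∃ u : Fin m → g.V, R g (Sum.elim v u)) := by
  induction m with
  | zero =>
    intro R h
    refine (h.subst (κ := ι) (Sum.elim id (fun i => i.elim0))).congr fun g v => ?_
    have hh : ∀ u : Fin 0 → g.V, Sum.elim v u =
        fun i => v (Sum.elim id (fun i : Fin 0 => i.elim0) i) := by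
      intro u; funext i; rcases i with i | i
      · rfl
      · exact i.elim0
    constructor
    · rintro ⟨u, hu⟩; rwa [hh] at hu
    · intro hu; exact ⟨fun i => i.elim0, by rwa [hh]⟩
  | succ m ih =>
    intro R h
    let f : ι ⊕ Fin (m + 1) → Option (ι ⊕ Fin m) :=
      Sum.elim (fun i => some (.inl i)) (Fin.cons none (fun j => some (.inr j)))
    refine (ih ((h.subst f).ex)).congr fun g v => ?_
    have hh : ∀ (u : Fin m → g.V) (w : g.V), (Sum.elim v (Fin.cons w u : Fin (m+1) → g.V)) =
        fun i => (f i).elim w (Sum.elim v u) := by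
      intro u w; funext i; rcases i with i | i
      · rfl
      · refine Fin.cases ?_ (fun j => ?_) i <;> simp [f]
    constructor
    · rintro ⟨u, hu⟩
      refine ⟨Fin.tail u, u 0, ?_⟩
      rw [← hh, Fin.cons_self_tail]; exact hu
    · rintro ⟨u, w, hu⟩
      exact ⟨Fin.cons w u, by rw [hh]; exact hu⟩

/-- Binary relations on head tuples with parameters. -/
abbrev vec3 {V : Type} (v : ι → V) (a b : Fin k → V) : ι ⊕ Fin k ⊕ Fin k → V :=
  Sum.elim v (Sum.elim a b)

theorem tc [Finite ι] {R : ∀ g : LGraph Sig, (ι → g.V) → (Fin k → g.V) → (Fin k → g.V) → Prop}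
    (h : Dfn k {true} (fun g (v : ι ⊕ Fin k ⊕ Fin k → g.V) => R g (fun i => v (.inl i))
      (fun i => v (.inr (.inl i))) (fun i => v (.inr (.inr i))))) :
    Dfn k {true} (fun g (v : ι ⊕ Fin k ⊕ Fin k → g.V) => ReflTransGen (R g (fun i => v (.inl i)))
      (fun i => v (.inr (.inl i))) (fun i => v (.inr (.inr i)))) := by
  intro e
  obtain ⟨M, hM⟩ := exists_bound e
  let xs : Fin k → ℕ := fun i => M + i
  let ys : Fin k → ℕ := fun i => M + k + i
  have hxs : Function.Injective xs := fun i j h => by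
    simp only [xs] at h; exact Fin.ext (by omega)
  have hys : Function.Injective ys := fun i j h => by
    simp only [ys] at h; exact Fin.ext (by omega)
  have hxy : ∀ i j, xs i ≠ ys j := fun i j h => by
    simp only [xs, ys] at h; have := i.2; omega
  let e' : ι ⊕ Fin k ⊕ Fin k → ℕ := Sum.elim (fun i => e (.inl i)) (Sum.elim xs ys)
  have hall : Dfn k {true} (fun g (v : ι ⊕ Fin k ⊕ Fin k → g.V) =>
      (R g (fun i => v (.inl i))
      (fun i => v (.inr (.inl i))) (fun i => v (.inr (.inr i))))) := h
  obtain ⟨φ, h1, h2, h3, h4⟩ := hall e'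
  -- make all bound variables occur free in the body
  have hfree : ∃ φ : GForm Sig k, GWF φ ∧ (∀ b ∈ ({true} : Set Bool), GPosTC b φ) ∧
      gfree φ ⊆ Set.range e' ∧ Set.range xs ∪ Set.range ys ⊆ gfree φ ∧
      ∀ (g : LGraph Sig) (ν : ℕ → g.V), GSat g φ ν ↔ R g (fun i => ν (e' (.inl i)))
        (fun i => ν (e' (.inr (.inl i)))) (fun i => ν (e' (.inr (.inr i)))) := by
    have key : ∀ l : List (Fin k), ∃ φ : GForm Sig k, GWF φ ∧
      (∀ b ∈ ({true} : Set Bool), GPosTC b φ) ∧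
      gfree φ ⊆ Set.range e' ∧ (∀ i ∈ l, xs i ∈ gfree φ ∧ ys i ∈ gfree φ) ∧
      ∀ (g : LGraph Sig) (ν : ℕ → g.V), GSat g φ ν ↔ R g (fun i => ν (e' (.inl i)))
        (fun i => ν (e' (.inr (.inl i)))) (fun i => ν (e' (.inr (.inr i)))) := by
      intro l
      induction l with
      | nil => exact ⟨φ, h1, h2, h3, by simp, h4⟩
      | cons j l ih =>
        obtain ⟨ψ, g1, g2, g3, g4, g5⟩ := ih
        refine ⟨.and (.and (.eq (xs j) (xs j)) (.eq (ys j) (ys j))) ψ, ⟨⟨trivial, trivial⟩, g1⟩,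
          fun b hb => ⟨⟨trivial, trivial⟩, g2 b hb⟩, ?_, ?_, ?_⟩
        · simp only [gfree, Set.union_subset_iff, Set.insert_subset_iff, Set.singleton_subset_iff]
          refine ⟨⟨⟨⟨.inr (.inl j), rfl⟩, ⟨.inr (.inl j), rfl⟩⟩,
            ⟨⟨.inr (.inr j), rfl⟩, ⟨.inr (.inr j), rfl⟩⟩⟩, g3⟩
        · intro i hi
          rcases List.mem_cons.1 hi with rfl | hi
          · simp [gfree]
          · exact ⟨Or.inr (g4 i hi).1, Or.inr (g4 i hi).2⟩
        · intro g ν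
          simp only [GSat, true_and]
          exact g5 g ν
    obtain ⟨ψ, g1, g2, g3, g4, g5⟩ := key (List.finRange k)
    refine ⟨ψ, g1, g2, g3, ?_, g5⟩
    rintro _ (⟨i, rfl⟩ | ⟨i, rfl⟩)
    · exact (g4 i (by simp)).1
    · exact (g4 i (by simp)).2
  obtain ⟨φ, h1, h2, h3, h5, h4⟩ := hfree
  refine ⟨.tc xs ys φ (fun i => e (.inr (.inl i))) (fun i => e (.inr (.inr i))),
    ⟨⟨hxs, hys, hxy⟩, h5, h1⟩, fun b hb => ⟨hb, h2 b hb⟩, ?_, ?_⟩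
  · rintro n ((⟨hn, hn'⟩ | ⟨i, rfl⟩) | ⟨i, rfl⟩)
    · obtain ⟨o, rfl⟩ := h3 hn
      rcases o with i | i | i
      · exact ⟨_, rfl⟩
      · exact absurd (Or.inl ⟨i, rfl⟩) hn'
      · exact absurd (Or.inr ⟨i, rfl⟩) hn'
    · exact ⟨_, rfl⟩
    · exact ⟨_, rfl⟩
  · intro g ν
    have hrel : (fun a b : Fin k → g.V => GSat g φ (updVec (updVec ν xs a) ys b)) =
        R g (fun i => ν (e (.inl i))) := by
      funext a b
      refine propext ((h4 g _).trans (iff_of_eq ?_))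
      congr 1
      · funext i
        have := hM (.inl i)
        simp only [e', Sum.elim_inl]
        rw [updVec_of_not, updVec_of_not]
        · intro j; simp only [xs]; omega
        · intro j; simp only [ys]; omega
      · funext i
        simp only [e', Sum.elim_inl, Sum.elim_inr]
        rw [updVec_of_not, updVec_apply _ _ _ hxs]
        intro j h; exact hxy _ _ h.symm
      · funext i
        simp only [e', Sum.elim_inr]
        rw [updVec_apply _ _ _ hys]
    simp only [GSat, hrel]

theorem comp [Finite ι]
    {R S : ∀ g : LGraph Sig, (ι → g.V) → (Fin k → g.V) → (Fin k → g.V) → Prop}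
    (hR : Dfn k B (fun g (v : ι ⊕ Fin k ⊕ Fin k → g.V) => R g (fun i => v (.inl i))
      (fun i => v (.inr (.inl i))) (fun i => v (.inr (.inr i)))))
    (hS : Dfn k B (fun g (v : ι ⊕ Fin k ⊕ Fin k → g.V) => S g (fun i => v (.inl i))
      (fun i => v (.inr (.inl i))) (fun i => v (.inr (.inr i))))) :
    Dfn k B (fun g (v : ι ⊕ Fin k ⊕ Fin k → g.V) => ∃ c, R g (fun i => v (.inl i))
      (fun i => v (.inr (.inl i))) c ∧ S g (fun i => v (.inl i)) c
      (fun i => v (.inr (.inr i)))) := by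
  have h1 := hR.subst (κ := (ι ⊕ Fin k ⊕ Fin k) ⊕ Fin k)
    (Sum.elim (fun i => .inl (.inl i)) (Sum.elim (fun i => .inl (.inr (.inl i))) .inr))
  have h2 := hS.subst (κ := (ι ⊕ Fin k ⊕ Fin k) ⊕ Fin k)
    (Sum.elim (fun i => .inl (.inl i)) (Sum.elim .inr (fun i => .inl (.inr (.inr i)))))
  exact (exVec k (h1.and h2)).congr (fun g v => by simp)

end Dfn
end NestedPebblesGraphs

namespace NestedPebblesGraphs

open Relation

variable {Sig : Type}

/-! ### Part D: from automata to formulas -/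

instance GTest.finite {k : ℕ} {X : Type} [Finite Sig] [Finite X] : Finite (GTest Sig k X) := by
  let f : (Fin k × Sig) ⊕ (Fin k × Sig) ⊕ (Fin k × Sig) ⊕ (Fin k × X) → GTest Sig k X := fun x =>
    match x with
    | .inl (i, a) => .lab i a
    | .inr (.inl (i, a)) => .inedge i a
    | .inr (.inr (.inl (i, a))) => .outedge i a
    | .inr (.inr (.inr (i, x))) => .peb i x
  refine Finite.of_surjective f ?_
  rintro (⟨i, a⟩ | ⟨i, a⟩ | ⟨i, a⟩ | ⟨i, x⟩)
  · exact ⟨.inl (i, a), rfl⟩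
  · exact ⟨.inr (.inl (i, a)), rfl⟩
  · exact ⟨.inr (.inr (.inl (i, a))), rfl⟩
  · exact ⟨.inr (.inr (.inr (i, x))), rfl⟩

instance GInstr.finite {k : ℕ} {X : Type} [Finite Sig] [Finite X] : Finite (GInstr Sig k X) := by
  let f : (Fin k × Sig) ⊕ (Fin k × Sig) ⊕ (Fin k × X) ⊕ X ⊕ (Fin k × X) ⊕
      (Bool × GTest Sig k X) → GInstr Sig k X := fun x =>
    match x with
    | .inl (i, a) => .inmove i a
    | .inr (.inl (i, a)) => .outmove i a
    | .inr (.inr (.inl (i, a))) => .dropPeb i a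
    | .inr (.inr (.inr (.inl x))) => .retrieve x
    | .inr (.inr (.inr (.inr (.inl (i, x))))) => .jump i x
    | .inr (.inr (.inr (.inr (.inr (b, t))))) => .test b t
  refine Finite.of_surjective f ?_
  rintro (⟨i, a⟩ | ⟨i, a⟩ | ⟨i, a⟩ | ⟨x⟩ | ⟨i, x⟩ | ⟨b, t⟩)
  · exact ⟨.inl (i, a), rfl⟩
  · exact ⟨.inr (.inl (i, a)), rfl⟩
  · exact ⟨.inr (.inr (.inl (i, a))), rfl⟩
  · exact ⟨.inr (.inr (.inr (.inl x))), rfl⟩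
  · exact ⟨.inr (.inr (.inr (.inr (.inl (i, x))))), rfl⟩
  · exact ⟨.inr (.inr (.inr (.inr (.inr (b, t))))), rfl⟩

section BigStep
variable {k : ℕ} (A : GWA Sig k) (g : LGraph Sig)

/-- Computations from and to the same stack that never touch that stack. -/
inductive BS : List (A.X × g.V) → A.Q → (Fin k → g.V) → A.Q → (Fin k → g.V) → Prop
  | refl (π q h) : BS π q h q h
  | flat (π p h q h' r h'') (ins : GInstr Sig k A.X) : BS π p h q h' → (q, ins, r) ∈ A.instr →
      gInstrStep g ins h' π h'' π → BS π p h r h''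
  | nest (π p h q h' q' r' h'' r) (i : Fin k) (x : A.X) : BS π p h q h' →
      (q, GInstr.dropPeb i x, q') ∈ A.instr → (∀ w, (x, w) ∉ π) →
      BS ((x, h' i) :: π) q' h' r' h'' → (r', GInstr.retrieve x, r) ∈ A.instr → BS π p h r h''

/-- One step at a fixed stack level. -/
def LevStep (π : List (A.X × g.V)) (p q : A.Q) (a b : Fin k → g.V) : Prop :=
  (∃ ins, (p, ins, q) ∈ A.instr ∧ gInstrStep g ins a π b π) ∨
  ∃ i x p' q', (p, GInstr.dropPeb i x, p') ∈ A.instr ∧ (∀ w, (x, w) ∉ π) ∧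
    BS A g ((x, a i) :: π) p' a q' b ∧ (q', GInstr.retrieve x, q) ∈ A.instr

theorem BS_iff (π : List (A.X × g.V)) (p q : A.Q) (a b : Fin k → g.V) :
    BS A g π p a q b ↔ ReflTransGen (fun x y : A.Q × (Fin k → g.V) =>
      LevStep A g π x.1 y.1 x.2 y.2) (p, a) (q, b) := by
  constructor
  · intro h
    induction h with
    | refl => exact .refl
    | flat π p h q h' r h'' ins _ h1 h2 ih => exact ih.tail (Or.inl ⟨ins, h1, h2⟩)
    | nest π p h q h' q' r' h'' r i x _ h1 h2 h3 h4 ih _ =>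
      exact ih.tail (Or.inr ⟨i, x, q', r', h1, h2, h3, h4⟩)
  · intro h
    have key : ∀ y : A.Q × (Fin k → g.V), ReflTransGen (fun x y : A.Q × (Fin k → g.V) =>
      LevStep A g π x.1 y.1 x.2 y.2) (p, a) y → BS A g π p a y.1 y.2 := by
      intro y hy
      induction hy with
      | refl => exact .refl _ _ _
      | tail _ h ih =>
        rcases h with ⟨ins, h1, h2⟩ | ⟨i, x, q', r', h1, h2, h3, h4⟩
        · exact .flat _ _ _ _ _ _ _ ins ih h1 h2
        · exact .nest _ _ _ _ _ _ _ _ _ i x ih h1 h2 h3 h4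
    exact key _ h

theorem BS_sound (π : List (A.X × g.V)) (p q : A.Q) (a b : Fin k → g.V)
    (h : BS A g π p a q b) : ReflTransGen (GStep A g) (p, a, π) (q, b, π) := by
  induction h with
  | refl => exact .refl
  | flat π p h q h' r h'' ins _ h1 h2 ih => exact ih.tail ⟨ins, h1, h2⟩
  | nest π p h q h' q' r' h'' r i x _ h1 h2 h3 h4 ih ih2 =>
    refine ih.trans (ReflTransGen.head (b := (q', h', (x, h' i) :: π)) ?_ (ih2.tail ?_))
    · exact ⟨_, h1, rfl, rfl, h2⟩
    · exact ⟨_, h4, rfl, _, rfl⟩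

/-- Invariant of reachable configurations. -/
def Inv (p0 : A.Q) (h0 : Fin k → g.V) : List (A.X × g.V) → A.Q → (Fin k → g.V) → Prop
  | [], q, h => BS A g [] p0 h0 q h
  | (x, w) :: τ, q, h => ∃ p h1 i p', Inv p0 h0 τ p h1 ∧ w = h1 i ∧
      (p, GInstr.dropPeb i x, p') ∈ A.instr ∧ (∀ w, (x, w) ∉ τ) ∧ BS A g ((x, w) :: τ) p' h1 q h

theorem Inv_ext (p0 : A.Q) (h0 : Fin k → g.V) (τ : List (A.X × g.V)) (q q' : A.Q)
    (h h' : Fin k → g.V) (hi : Inv A g p0 h0 τ q h) (hb : BS A g τ q h q' h') :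
    Inv A g p0 h0 τ q' h' := by
  have tr : ∀ τ p a, BS A g τ p a q h → BS A g τ q h q' h' → BS A g τ p a q' h' := by
    intro τ p a h1 h2
    rw [BS_iff] at *
    exact h1.trans h2
  rcases τ with _ | ⟨⟨x, w⟩, τ⟩
  · exact tr _ _ _ hi hb
  · obtain ⟨p, h1, i, p', h2, h3, h4, h5, h6⟩ := hi
    exact ⟨p, h1, i, p', h2, h3, h4, h5, tr _ _ _ h6 hb⟩

theorem reach_iff_BS (p0 q : A.Q) (h0 h : Fin k → g.V) :
    ReflTransGen (GStep A g) (p0, h0, []) (q, h, []) ↔ BS A g [] p0 h0 q h := by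
  refine ⟨fun hr => ?_, BS_sound A g _ _ _ _ _⟩
  have key : ∀ c, ReflTransGen (GStep A g) (p0, h0, []) c → Inv A g p0 h0 c.2.2 c.1 c.2.1 := by
    intro c hc
    induction hc with
    | refl => exact BS.refl _ _ _
    | @tail c d _ hs ih =>
      obtain ⟨q, h, π⟩ := c
      obtain ⟨q', h', π'⟩ := d
      obtain ⟨ins, h1, h2⟩ := hs
      have flat : π' = π → Inv A g p0 h0 π' q' h' := by
        rintro rfl
        exact Inv_ext A g _ _ _ _ _ _ _ ih (.flat _ _ _ _ _ _ _ ins (.refl _ _ _) h1 h2)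
      cases ins with
      | inmove i a => exact flat h2.1
      | outmove i a => exact flat h2.1
      | jump i a => exact flat h2.1
      | test b t => exact flat h2.2.1
      | dropPeb i x =>
        obtain ⟨e1, e2, h3⟩ := h2
        dsimp only at e1 e2 h1 h3 ih ⊢
        subst e1 e2
        exact ⟨q, h', i, q', ih, rfl, h1, h3, .refl _ _ _⟩
      | retrieve x =>
        obtain ⟨e1, w, e2⟩ := h2
        dsimp only at e1 e2 h1 ih ⊢
        subst e1 e2
        obtain ⟨p, h2, i, p', h3, rfl, h5, h6, h7⟩ := ih
        exact Inv_ext A g _ _ _ _ _ _ _ h3 (.nest _ _ _ _ _ _ _ _ _ i x (.refl _ _ _) h5 h6 h7 h1)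
  exact key _ hr

end BigStep

/-- The stack given by the list of pebble names and their positions. -/
def stk {X V : Type} (D : List X) (v : X → V) : List (X × V) := D.map (fun x => (x, v x))

theorem mem_stk {X V : Type} (D : List X) (v : X → V) (x : X) (w : V) :
    (x, w) ∈ stk D v ↔ x ∈ D ∧ w = v x := by
  simp only [stk, List.mem_map, Prod.mk.injEq]
  constructor
  · rintro ⟨y, h1, rfl, rfl⟩; exact ⟨h1, rfl⟩
  · rintro ⟨h1, rfl⟩; exact ⟨x, h1, rfl, rfl⟩

section
variable {k : ℕ} {X : Type} [Finite X] {B : Set Bool}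

theorem Dfn_test (D : List X) (τ : GTest Sig k X) :
    Dfn k B (fun g (v : X ⊕ Fin k → g.V) =>
      gTestHolds g τ (fun i => v (.inr i)) (stk D fun x => v (.inl x))) := by
  cases τ with
  | lab i a => exact Dfn.lab a (Sum.inr i : X ⊕ Fin k)
  | inedge i a => exact (Dfn.edg a none (some (Sum.inr i : X ⊕ Fin k))).ex
  | outedge i a => exact (Dfn.edg a (some (Sum.inr i : X ⊕ Fin k)) none).ex
  | peb i x =>
    refine ((Dfn.const (x ∈ D)).and (Dfn.eq (.inr i) (.inl x))).congr fun g v => ?_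
    simp [gTestHolds, mem_stk]

theorem Dfn_btest (D : List X) (b : Bool) (τ : GTest Sig k X) :
    Dfn k B (fun g (v : X ⊕ Fin k → g.V) =>
      gTestHolds g τ (fun i => v (.inr i)) (stk D fun x => v (.inl x)) ↔ b = true) := by
  cases b with
  | true => exact (Dfn_test D τ).congr (by simp)
  | false => exact (Dfn.not (Dfn_test D τ)).congr (by simp)

theorem Dfn_others (i : Fin k) : Dfn (Sig := Sig) k B (fun g (v : X ⊕ Fin k ⊕ Fin k → g.V) =>
    ∀ h, h ≠ i → v (.inr (.inr h)) = v (.inr (.inl h))) := by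
  refine Dfn.iall fun h => ?_
  by_cases hi : h = i
  · exact (Dfn.const True).congr (by simp [hi])
  · exact (Dfn.eq (Sum.inr (Sum.inr h)) (Sum.inr (Sum.inl h))).congr (by simp [hi])

theorem Dfn_flat (D : List X) (ins : GInstr Sig k X) :
    Dfn k B (fun g (v : X ⊕ Fin k ⊕ Fin k → g.V) =>
      gInstrStep g ins (fun i => v (.inr (.inl i))) (stk D fun x => v (.inl x))
        (fun i => v (.inr (.inr i))) (stk D fun x => v (.inl x))) := by
  cases ins with
  | inmove i a =>
    refine ((Dfn.edg a (.inr (.inr i)) (.inr (.inl i))).and (Dfn_others i)).congr fun g v => ?_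
    simp [gInstrStep]
  | outmove i a =>
    refine ((Dfn.edg a (.inr (.inl i)) (.inr (.inr i))).and (Dfn_others i)).congr fun g v => ?_
    simp [gInstrStep]
  | dropPeb i x => exact (Dfn.const False).congr (by simp [gInstrStep])
  | retrieve x => exact (Dfn.const False).congr (by simp [gInstrStep])
  | jump i x =>
    refine (((Dfn.const (x ∈ D)).and (Dfn.eq (.inr (.inr i)) (.inl x))).and
      (Dfn_others i)).congr fun g v => ?_
    simp [gInstrStep, mem_stk]
  | test b τ =>
    refine ((Dfn.iall fun h => Dfn.eq (.inr (.inr h)) (.inr (.inl h))).and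
      ((Dfn_btest D b τ).subst (κ := X ⊕ Fin k ⊕ Fin k)
        (Sum.elim .inl (fun i => .inr (.inl i))))).congr fun g v => ?_
    simp [gInstrStep, funext_iff]

theorem Dfn_appl (ins : GInstr Sig k X) :
    Dfn k Set.univ (fun g (v : Fin k → g.V) =>
      ∃ hs' π', gInstrStep g ins v [] hs' π') := by
  have upd : ∀ (g : LGraph Sig) (i : Fin k) (v : Fin k → g.V) (P : g.V → Prop),
      (∃ hs' : Fin k → g.V, P (hs' i) ∧ ∀ h, h ≠ i → hs' h = v h) ↔ ∃ u, P u := by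
    intro g i v P
    constructor
    · rintro ⟨hs', h, _⟩; exact ⟨_, h⟩
    · rintro ⟨u, hu⟩
      exact ⟨Function.update v i u, by simpa using hu, fun h hh => by simp [hh]⟩
  cases ins with
  | inmove i a =>
    refine (Dfn.edg a none (some i)).ex.congr fun g v => ?_
    simp only [gInstrStep, exists_eq_left]
    exact upd g i v (fun u => g.edge a u (v i))
  | outmove i a =>
    refine (Dfn.edg a (some i) none).ex.congr fun g v => ?_
    simp only [gInstrStep, exists_eq_left]
    exact upd g i v (fun u => g.edge a (v i) u)
  | dropPeb i x => exact (Dfn.const True).congr (by simp [gInstrStep])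
  | retrieve x => exact (Dfn.const False).congr (by simp [gInstrStep])
  | jump i x => exact (Dfn.const False).congr (by simp [gInstrStep])
  | test b τ =>
    cases τ with
    | lab i a =>
      cases b with
      | true => exact (Dfn.lab a i).congr (by simp [gInstrStep, gTestHolds])
      | false => exact (Dfn.not (Dfn.lab a i)).congr (by simp [gInstrStep, gTestHolds])
    | inedge i a =>
      have := (Dfn.edg (k := k) (B := Set.univ) a none (some i)).ex
      cases b with
      | true => exact this.congr (by simp [gInstrStep, gTestHolds])
      | false => exact (Dfn.not this).congr (by simp [gInstrStep, gTestHolds])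
    | outedge i a =>
      have := (Dfn.edg (k := k) (B := Set.univ) a (some i) none).ex
      cases b with
      | true => exact this.congr (by simp [gInstrStep, gTestHolds])
      | false => exact (Dfn.not this).congr (by simp [gInstrStep, gTestHolds])
    | peb i x => exact (Dfn.const (b = false)).congr (by simp [gInstrStep, gTestHolds])

theorem Dfn_halt [Finite Sig] (A : GWA Sig k) (q : A.Q) :
    Dfn k B (fun g (v : Fin k → g.V) => GHaltingConf A g (q, v, [])) := by
  have _ := A.finQ
  have _ := A.finX
  have h : Dfn k B (fun g (v : Fin k → g.V) => ¬ ∃ ins, ∃ q', (q, ins, q') ∈ A.instr ∧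
      ∃ hs' π', gInstrStep g ins v [] hs' π') :=
    Dfn.not (Dfn.iex fun ins => Dfn.iex fun q' => (Dfn.const _).and (Dfn_appl ins))
  refine h.congr fun g v => ?_
  simp only [GHaltingConf, GStep]
  constructor
  · rintro h ⟨ins, q', h1, hs', π', h2⟩
    exact h (q', hs', π') ⟨ins, h1, h2⟩
  · rintro h ⟨q', hs', π'⟩ ⟨ins, h1, h2⟩
    exact h ⟨ins, q', h1, hs', π', h2⟩

theorem Dfn_BS [Finite Sig] (A : GWA Sig k) (n : ℕ) : ∀ (D : List A.X), D.Nodup →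
    Nat.card A.X ≤ D.length + n → ∀ p q,
    Dfn k {true} (fun g (v : A.X ⊕ Fin k ⊕ Fin k → g.V) =>
      BS A g (stk D fun x => v (.inl x)) p (fun i => v (.inr (.inl i))) q
        (fun i => v (.inr (.inr i)))) := by
  classical
  have _ := A.finQ
  have _ := A.finX
  have main : ∀ D : List A.X, (∀ x ∉ D, ∀ p q,
      Dfn k {true} (fun g (v : A.X ⊕ Fin k ⊕ Fin k → g.V) =>
      BS A g (stk (x :: D) fun x => v (.inl x)) p (fun i => v (.inr (.inl i))) q
        (fun i => v (.inr (.inr i))))) → ∀ p q,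
      Dfn k {true} (fun g (v : A.X ⊕ Fin k ⊕ Fin k → g.V) =>
      BS A g (stk D fun x => v (.inl x)) p (fun i => v (.inr (.inl i))) q
        (fun i => v (.inr (.inr i)))) := by
    intro D hD p q
    have hstep : ∀ p q, Dfn k {true} (fun g (v : A.X ⊕ Fin k ⊕ Fin k → g.V) =>
      LevStep A g (stk D fun x => v (.inl x)) p q (fun i => v (.inr (.inl i)))
        (fun i => v (.inr (.inr i)))) := by
      intro p q
      refine Dfn.or (Dfn.iex fun ins => (Dfn.const _).and (Dfn_flat D ins)) ?_
      refine Dfn.iex fun i => Dfn.iex fun x => Dfn.iex fun p' => Dfn.iex fun q' => ?_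
      by_cases hx : x ∈ D
      · refine (Dfn.const False).congr fun g v => ?_
        simp only [iff_false]
        rintro ⟨_, h, _⟩
        exact h _ ((mem_stk _ _ _ _).2 ⟨hx, rfl⟩)
      · refine ((Dfn.const ((p, GInstr.dropPeb i x, p') ∈ A.instr)).and
          (((hD x hx p' q').subst (κ := A.X ⊕ Fin k ⊕ Fin k)
            (Sum.elim (fun y => if y = x then .inr (.inl i) else .inl y) .inr)).and
          (Dfn.const ((q', GInstr.retrieve x, q) ∈ A.instr)))).congr fun g v => ?_
        have h1 : ∀ w, (x, w) ∉ stk D fun x => v (.inl x) := by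
          intro w h; exact hx ((mem_stk _ _ _ _).1 h).1
        have h2 : (stk (x :: D) fun y => v (Sum.elim (fun y => if y = x then .inr (.inl i)
            else .inl y) .inr (.inl y))) = (x, v (.inr (.inl i))) :: stk D fun x => v (.inl x) := by
          simp only [stk, List.map_cons, Sum.elim_inl, if_true]
          congr 1
          refine List.map_congr_left fun y hy => ?_
          rw [if_neg]
          rintro rfl; exact hx hy
        simp only [h1, h2, not_false_eq_true, implies_true, true_and, Sum.elim_inr]
    have := kleene (I := Σ g : LGraph Sig, (A.X → g.V)) (α := fun i => (Fin k → i.1.V))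
      (fun R => Dfn k {true} (fun g (v : A.X ⊕ Fin k ⊕ Fin k → g.V) =>
        R ⟨g, fun x => v (.inl x)⟩ (fun i => v (.inr (.inl i))) (fun i => v (.inr (.inr i)))))
      (Dfn.const False) (fun R S => Dfn.or)
      (fun R S => Dfn.comp (R := fun g v => R ⟨g, v⟩) (S := fun g v => S ⟨g, v⟩))
      (fun R => Dfn.tc (R := fun g v => R ⟨g, v⟩))
      (fun p q i => LevStep A i.1 (stk D i.2) p q) hstep p q
    exact this.congr fun g v => BS_iff A g _ p q _ _
  induction n with
  | zero =>
    intro D hn hD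
    refine main D fun x hx => absurd ?_ hx
    have h1 : D.toFinset = Finset.univ := by
      apply Finset.eq_univ_of_card
      rw [List.toFinset_card_of_nodup hn]
      rw [Nat.card_eq_fintype_card] at hD
      refine le_antisymm (hn.length_le_card) (by simpa using hD)
    have := Finset.mem_univ x
    rw [← h1] at this
    simpa using this
  | succ n ih =>
    intro D hn hD
    refine main D fun x hx => ih (x :: D) (List.nodup_cons.2 ⟨hx, hn⟩) ?_
    simp only [List.length_cons]; omega

theorem Dfn_accepts [Finite Sig] (A : GWA Sig k) :
    Dfn (ι := Empty) k {true} (fun g _ => GAccepts A g) := by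
  have _ := A.finQ
  have _ := A.finX
  have hBS := fun q => Dfn_BS A (Nat.card A.X) [] List.nodup_nil (by simp) A.q0 q
  have h : Dfn (Sig := Sig) (ι := Empty) k {true} (fun g v => ∀ u : g.V, ∃ q, ∃ hs : Fin k → g.V,
      q ∈ A.acc ∧ BS A g [] A.q0 (fun _ => u) q hs ∧ GHaltingConf A g (q, hs, [])) := by
    refine Dfn.all (R := fun g v => ∃ q, ∃ hs : Fin k → g.V,
      q ∈ A.acc ∧ BS A g [] A.q0 (fun _ => v none) q hs ∧ GHaltingConf A g (q, hs, [])) ?_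
    refine Dfn.iex fun q => ?_
    refine Dfn.exVec k (R := fun g v => q ∈ A.acc ∧
      BS A g [] A.q0 (fun _ => v (.inl none)) q (fun i => v (.inr i)) ∧
      GHaltingConf A g (q, (fun i => v (.inr i)), [])) ?_
    refine (Dfn.const _).and (Dfn.and ?_ ((Dfn_halt A q).subst Sum.inr))
    exact (hBS q).subst (κ := Option Empty ⊕ Fin k)
      (Sum.elim (fun _ => .inl none) (Sum.elim (fun _ => .inl none) .inr))
  refine h.congr fun g v => ?_
  simp only [GAccepts, AccFrom, reach_iff_BS]

end

theorem NPTWAg_subset (Sig : Type) [Fintype Sig] (F : Set (LGraph Sig)) (k : ℕ) :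
    NPTWAg Sig F k ⊆ FOposTCg Sig F k := by
  rintro L ⟨A, _, _, rfl⟩
  obtain ⟨φ, h1, h2, h3, h4⟩ := Dfn_accepts A (fun i : Empty => i.elim)
  refine ⟨φ, h1, h2 true rfl, ?_, ?_⟩
  · rw [← Set.subset_empty_iff]
    refine h3.trans ?_
    rintro _ ⟨i, _⟩
    exact i.elim
  · ext g
    refine and_congr_right fun _ => ?_
    constructor
    · intro h ν; exact (h4 g ν).2 h
    · intro h
      exact (h4 g (fun _ => g.neV.some)).1 (h _)

end NestedPebblesGraphs

namespace NestedPebblesGraphs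

open Relation

variable {Sig : Type}

/-! ### Part E: from formulas to automata -/

/-- Instructions that are not jumps. -/
abbrev NJIns (Sig : Type) (k : ℕ) (X : Type) := {ins : GInstr Sig k X // ∀ i x, ins ≠ .jump i x}

/-- Head positions together with the stack of pebbles. -/
abbrev HC (k : ℕ) (X : Type) (g : LGraph Sig) : Type := (Fin k → g.V) × List (X × g.V)

/-- Semantics of instructions as a relation family. -/
def gsem {k : ℕ} {X : Type} (ins : NJIns Sig k X) : RelF (fun g : LGraph Sig => HC k X g) :=
  fun g c c' => gInstrStep g ins.1 c.1 c.2 c'.1 c'.2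

/-- Relations computed by programs. -/
def Pr {k : ℕ} {X : Type} (R : RelF (fun g : LGraph Sig => HC k X g)) : Prop :=
  IsProg gsem R

/-- Programs that only test. -/
def PrT {k : ℕ} {X : Type} (P : ∀ g : LGraph Sig, HC k X g → Prop) : Prop :=
  Pr (fun g (c c' : HC k X g) => c' = c ∧ P g c)

section
variable {k : ℕ} {X : Type}

theorem Pr.congr {R S : RelF (fun g : LGraph Sig => HC k X g)} (h : Pr R)
    (e : ∀ g c c', S g c c' ↔ R g c c') : Pr S := by
  have : S = R := by
    funext g c c'
    exact propext (e g c c')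
  rw [this]; exact h

theorem Pr.or {R S : RelF (fun g : LGraph Sig => HC k X g)} (h : Pr R) (h' : Pr S) :
    Pr (fun g c c' => R g c c' ∨ S g c c') := IsProg.or _ _ h h'

theorem Pr.comp {R S : RelF (fun g : LGraph Sig => HC k X g)} (h : Pr R) (h' : Pr S) :
    Pr (fun g a b => ∃ c, R g a c ∧ S g c b) := IsProg.comp _ _ h h'

theorem Pr.star {R : RelF (fun g : LGraph Sig => HC k X g)} (h : Pr R) :
    Pr (fun g a b => ReflTransGen (R g) a b) := IsProg.star _ h

theorem Pr.bot : Pr (fun (g : LGraph Sig) (_ _ : HC k X g) => False) := IsProg.bot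

theorem Pr.iex {J : Type*} [Finite J] {R : J → RelF (fun g : LGraph Sig => HC k X g)}
    (h : ∀ j, Pr (R j)) : Pr (fun g c c' => ∃ j, R j g c c') :=
  clos_iUnion Pr Pr.bot (fun _ _ => Pr.or) R h

theorem Pr.id : Pr (fun (g : LGraph Sig) (c c' : HC k X g) => c' = c) := by
  refine Pr.bot.star.congr fun g c c' => ?_
  constructor
  · rintro rfl; exact .refl
  · intro h
    rcases ReflTransGen.cases_head h with h | ⟨_, h, _⟩
    · exact h.symm
    · exact h.elim

theorem Pr.constAnd {R : RelF (fun g : LGraph Sig => HC k X g)} (P : Prop) (h : Pr R) :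
    Pr (fun g c c' => P ∧ R g c c') := by
  by_cases hp : P
  · exact h.congr (by simp [hp])
  · exact Pr.bot.congr (by simp [hp])

theorem PrT.congr {P P' : ∀ g : LGraph Sig, HC k X g → Prop} (h : PrT P)
    (e : ∀ g c, P' g c ↔ P g c) : PrT P' :=
  Pr.congr h fun g c c' => by rw [e]

theorem PrT.const (P : Prop) : PrT (fun (g : LGraph Sig) (_ : HC k X g) => P) :=
  (Pr.id.constAnd P).congr fun g c c' => and_comm

theorem PrT.and {P P' : ∀ g : LGraph Sig, HC k X g → Prop} (h : PrT P) (h' : PrT P') :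
    PrT (fun g c => P g c ∧ P' g c) := by
  refine (Pr.comp h h').congr fun g c c' => ?_
  constructor
  · rintro ⟨rfl, h1, h2⟩; exact ⟨_, ⟨rfl, h1⟩, rfl, h2⟩
  · rintro ⟨_, ⟨rfl, h1⟩, rfl, h2⟩; exact ⟨rfl, h1, h2⟩

theorem PrT.imp {P : ∀ g : LGraph Sig, HC k X g → Prop} (A : Prop) (h : A → PrT P) :
    PrT (fun g c => A → P g c) := by
  by_cases ha : A
  · exact (h ha).congr (by simp [ha])
  · exact (PrT.const True).congr (by simp [ha])

theorem PrT.iall {J : Type*} [Finite J] {P : J → ∀ g : LGraph Sig, HC k X g → Prop}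
    (h : ∀ j, PrT (P j)) : PrT (fun g c => ∀ j, P j g c) := by
  classical
  have _ := Fintype.ofFinite J
  have : ∀ l : List J, PrT (fun g c => ∀ j ∈ l, P j g c) := by
    intro l
    induction l with
    | nil => exact (PrT.const True).congr (by simp)
    | cons j l ih => exact ((h j).and ih).congr (by simp)
  exact (this Finset.univ.toList).congr (by simp)

theorem PrT.test (b : Bool) (τ : GTest Sig k X) :
    PrT (fun g c => gTestHolds g τ c.1 c.2 ↔ b = true) := by
  have : Pr (gsem (Sig := Sig) (k := k) (X := X) ⟨.test b τ, by simp⟩) := IsProg.ins _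
  refine this.congr fun g c c' => ?_
  simp only [gsem, gInstrStep, Prod.ext_iff, and_assoc]

theorem Pr.walk [Finite Sig] (i : Fin k) :
    Pr (fun (g : LGraph Sig) (c c' : HC k X g) => c'.2 = c.2 ∧ ∀ h, h ≠ i → c'.1 h = c.1 h) := by
  have h1 : ∀ a, Pr (gsem (Sig := Sig) (k := k) (X := X) ⟨.inmove i a, by simp⟩) :=
    fun a => IsProg.ins _
  have h2 : ∀ a, Pr (gsem (Sig := Sig) (k := k) (X := X) ⟨.outmove i a, by simp⟩) :=
    fun a => IsProg.ins _
  refine (((Pr.iex h1).or (Pr.iex h2)).star).congr fun g c c' => ?_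
  constructor
  · obtain ⟨hs, π⟩ := c
    obtain ⟨hs', π'⟩ := c'
    rintro ⟨e1, e2⟩
    dsimp only at e1 e2
    subst e1
    have key : ∀ v, ReflTransGen (fun x y => (∃ a, g.edge a x y) ∨ (∃ a, g.edge a y x)) (hs i) v →
      ReflTransGen (fun c c' => (∃ a, gsem (Sig := Sig) (k := k) (X := X) ⟨.inmove i a, by simp⟩ g c c')
        ∨ (∃ a, gsem (Sig := Sig) (k := k) (X := X) ⟨.outmove i a, by simp⟩ g c c'))
        (hs, π') (Function.update hs i v, π') := by
      intro v hv
      induction hv with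
      | refl => rw [Function.update_eq_self]
      | tail _ h ih =>
        refine ih.tail ?_
        rcases h with ⟨a, h⟩ | ⟨a, h⟩
        · exact Or.inr ⟨a, rfl, by simpa using h, fun j hj => by simp [hj]⟩
        · exact Or.inl ⟨a, rfl, by simpa using h, fun j hj => by simp [hj]⟩
    have := key (hs' i) (g.conn _ _)
    convert this using 2
    funext j
    by_cases hj : j = i
    · subst hj; simp
    · simp [hj, e2]
  · intro h
    induction h with
    | refl => exact ⟨rfl, fun _ _ => rfl⟩
    | tail _ h ih =>
      rcases h with ⟨a, h1, _, h3⟩ | ⟨a, h1, _, h3⟩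
      · exact ⟨h1.trans ih.1, fun j hj => (h3 j hj).trans (ih.2 j hj)⟩
      · exact ⟨h1.trans ih.1, fun j hj => (h3 j hj).trans (ih.2 j hj)⟩

/-- Composing a relation with a test. -/
theorem Pr.thenT {R : RelF (fun g : LGraph Sig => HC k X g)} (h : Pr R)
    {P : ∀ g : LGraph Sig, HC k X g → Prop} (h' : PrT P) :
    Pr (fun g c c' => R g c c' ∧ P g c') := by
  refine (Pr.comp h h').congr fun g c c' => ?_
  constructor
  · rintro ⟨h1, h2⟩; exact ⟨_, h1, rfl, h2⟩
  · rintro ⟨_, h1, rfl, h2⟩; exact ⟨h1, h2⟩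

theorem Pr.instr [Finite Sig] (ins : GInstr Sig k X) :
    Pr (fun g c c' => gInstrStep g ins c.1 c.2 c'.1 c'.2) := by
  by_cases h : ∀ i x, ins ≠ .jump i x
  · exact IsProg.ins (sem := gsem) (⟨ins, h⟩ : NJIns Sig k X)
  · push Not at h
    obtain ⟨i, x, rfl⟩ := h
    refine ((Pr.walk i).thenT (PrT.test true (.peb i x))).congr fun g c c' => ?_
    simp only [gInstrStep, gTestHolds, iff_true]
    constructor
    · rintro ⟨h1, h2, h3⟩; exact ⟨⟨h1, h3⟩, h1 ▸ h2⟩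
    · rintro ⟨⟨h1, h3⟩, h2⟩; exact ⟨h1, h1 ▸ h2, h3⟩

theorem Pr.walkAll [Finite Sig] :
    Pr (fun (g : LGraph Sig) (c c' : HC k X g) => c'.2 = c.2) := by
  have : ∀ l : List (Fin k), Pr (fun (g : LGraph Sig) (c c' : HC k X g) =>
      c'.2 = c.2 ∧ ∀ h, h ∉ l → c'.1 h = c.1 h) := by
    intro l
    induction l with
    | nil =>
      refine Pr.id.congr fun g c c' => ?_
      simp [Prod.ext_iff, funext_iff, and_comm]
    | cons i l ih =>
      refine ((Pr.walk i).comp ih).congr fun g c c' => ?_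
      constructor
      · rintro ⟨h1, h2⟩
        refine ⟨(Function.update c.1 i (c'.1 i), c.2), ⟨rfl, fun h hh => by simp [hh]⟩, h1, ?_⟩
        intro h hh
        by_cases hi : h = i
        · subst hi; simp
        · simp [hi]; exact h2 h (by simp [hi, hh])
      · rintro ⟨d, ⟨h1, h2⟩, h3, h4⟩
        refine ⟨h3.trans h1, fun h hh => ?_⟩
        simp only [List.mem_cons, not_or] at hh
        rw [h4 h hh.2, h2 h hh.1]
  exact (this (List.finRange k)).congr (by simp)

theorem Pr.gotoAll [Finite Sig] (x : Fin k → X) :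
    Pr (fun (g : LGraph Sig) (c c' : HC k X g) => c'.2 = c.2 ∧ ∀ i, (x i, c'.1 i) ∈ c.2) := by
  refine (Pr.walkAll.thenT (PrT.iall fun i => PrT.test true (.peb i (x i)))).congr fun g c c' => ?_
  simp only [gTestHolds, iff_true]
  exact and_congr_right fun h => by rw [h]

theorem Pr.dropAll [Finite Sig] (x : Fin k → X) (hx : Function.Injective x) :
    Pr (fun (g : LGraph Sig) (c c' : HC k X g) => c'.1 = c.1 ∧
      c'.2 = (List.finRange k).map (fun i => (x i, c.1 i)) ++ c.2 ∧ ∀ i w, (x i, w) ∉ c.2) := by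
  have : ∀ l : List (Fin k), l.Nodup → Pr (fun (g : LGraph Sig) (c c' : HC k X g) =>
      c'.1 = c.1 ∧ c'.2 = l.map (fun i => (x i, c.1 i)) ++ c.2 ∧ ∀ i ∈ l, ∀ w, (x i, w) ∉ c.2) := by
    intro l
    induction l with
    | nil =>
      intro _
      refine Pr.id.congr fun g c c' => ?_
      simp [Prod.ext_iff]
    | cons i l ih =>
      intro hl
      rw [List.nodup_cons] at hl
      refine ((ih hl.2).comp (Pr.instr (.dropPeb i (x i)))).congr fun g c c' => ?_
      have fr : ∀ w, (x i, w) ∉ l.map (fun i => (x i, c.1 i)) := by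
        intro w hw
        simp only [List.mem_map, Prod.mk.injEq] at hw
        obtain ⟨j, hj, e, _⟩ := hw
        exact hl.1 (hx e ▸ hj)
      constructor
      · rintro ⟨h1, h2, h3⟩
        refine ⟨(c.1, l.map (fun i => (x i, c.1 i)) ++ c.2), ⟨rfl, rfl, fun j hj => h3 j (by simp [hj])⟩,
          h1, by simpa using h2, fun w hw => ?_⟩
        rcases List.mem_append.1 hw with hw | hw
        · exact fr w hw
        · exact h3 i (by simp) w hw
      · rintro ⟨⟨d1, d2⟩, ⟨h1, h2, h3⟩, h4, h5, h6⟩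
        dsimp only at h1 h2 h4 h5 h6
        subst h1 h2
        refine ⟨h4, by simpa using h5, fun j hj w hw => ?_⟩
        rcases List.mem_cons.1 hj with rfl | hj
        · exact h6 w (List.mem_append_right _ hw)
        · exact h3 j hj w hw
  exact (this _ (List.nodup_finRange k)).congr (by simp)

theorem Pr.retr [Finite Sig] (ns : List X) :
    Pr (fun (g : LGraph Sig) (c c' : HC k X g) => c'.1 = c.1 ∧
      ∃ τ, c.2 = τ ++ c'.2 ∧ τ.map Prod.fst = ns) := by
  induction ns with
  | nil =>
    refine Pr.id.congr fun g c c' => ?_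
    simp only [List.map_eq_nil_iff, exists_eq_right, List.nil_append, Prod.ext_iff]
    exact and_congr_right fun _ => eq_comm
  | cons x ns ih =>
    refine ((Pr.instr (.retrieve x)).comp ih).congr fun g c c' => ?_
    constructor
    · rintro ⟨h1, τ, h2, h3⟩
      rcases τ with _ | ⟨⟨y, w⟩, τ⟩
      · simp at h3
      · simp only [List.map_cons, List.cons.injEq] at h3
        obtain ⟨rfl, h3⟩ := h3
        exact ⟨(c.1, τ ++ c'.2), ⟨rfl, w, by simpa using h2⟩, h1, τ, rfl, h3⟩
    · rintro ⟨⟨d1, d2⟩, ⟨h1, w, h2⟩, h4, τ, h5, h6⟩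
      dsimp only at h1 h2 h4 h5
      subst h1 h5
      exact ⟨h4, (x, w) :: τ, by simpa using h2, by simp [h6]⟩

end
end NestedPebblesGraphs

namespace NestedPebblesGraphs

open Relation

variable {Sig : Type}

/-- `P` is checked by some program, under the precondition `pre`. -/
def Ck (k : ℕ) {X : Type} (pre : ∀ g : LGraph Sig, (ℕ → g.V) → List (X × g.V) → Prop)
    (P : ∀ g : LGraph Sig, (ℕ → g.V) → Prop) : Prop :=
  ∃ R : RelF (fun g : LGraph Sig => HC k X g), Pr R ∧ ∀ g ν π, pre g ν π → ∀ hs,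
    (∀ c', R g (hs, π) c' → c'.2 = π ∧ P g ν) ∧ (P g ν → ∃ hs', R g (hs, π) (hs', π))

/-- Only pebbles from `U` are on the graph, and the variables in `S` are represented by pebbles. -/
def Good {X : Type} (F : Set (LGraph Sig)) (U : Set X) (S : Set ℕ) (e : ℕ → X)
    (g : LGraph Sig) (ν : ℕ → g.V) (π : List (X × g.V)) : Prop :=
  g ∈ F ∧ (∀ p ∈ π, p.1 ∈ U) ∧ ∀ x ∈ S, ∀ w, (e x, w) ∈ π ↔ w = ν x

section
variable {k : ℕ} {X : Type} {F : Set (LGraph Sig)} {U : Set X} {S : Set ℕ} {e : ℕ → X}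

theorem Good.mem {g : LGraph Sig} {ν : ℕ → g.V} {π : List (X × g.V)} (h : Good F U S e g ν π)
    {x : ℕ} (hx : x ∈ S) : e x ∈ U :=
  h.2.1 (e x, ν x) ((h.2.2 x hx _).2 rfl)

theorem Good.mono {g : LGraph Sig} {ν : ℕ → g.V} {π : List (X × g.V)} (h : Good F U S e g ν π)
    {S' : Set ℕ} (hS : S' ⊆ S) : Good F U S' e g ν π :=
  ⟨h.1, h.2.1, fun x hx => h.2.2 x (hS hx)⟩

theorem Good.ext {g : LGraph Sig} {ν : ℕ → g.V} {π : List (X × g.V)} (h : Good F U S e g ν π)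
    (τ : List (X × g.V)) (W : Set X) (hτ : ∀ p ∈ τ, p.1 ∈ W) (hW : ∀ x ∈ W, x ∉ U) :
    Good F (U ∪ W) S e g ν (τ ++ π) := by
  refine ⟨h.1, ?_, ?_⟩
  · intro p hp
    rcases List.mem_append.1 hp with hp | hp
    · exact Or.inr (hτ p hp)
    · exact Or.inl (h.2.1 p hp)
  · intro x hx w
    rw [← h.2.2 x hx w, List.mem_append]
    exact or_iff_right fun hm => hW _ (hτ _ hm) (h.mem hx)

theorem Ck.congr {pre : ∀ g : LGraph Sig, (ℕ → g.V) → List (X × g.V) → Prop}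
    {P P' : ∀ g : LGraph Sig, (ℕ → g.V) → Prop} (h : Ck k pre P) (hP : ∀ g ν, P' g ν ↔ P g ν) :
    Ck k pre P' := by
  obtain ⟨R, h1, h2⟩ := h
  refine ⟨R, h1, fun g ν π hp hs => ?_⟩
  rw [hP]
  exact h2 g ν π hp hs

theorem Ck.pre {pre pre' : ∀ g : LGraph Sig, (ℕ → g.V) → List (X × g.V) → Prop}
    {P : ∀ g : LGraph Sig, (ℕ → g.V) → Prop} (h : Ck k pre P)
    (hp : ∀ g ν π, pre' g ν π → pre g ν π) : Ck k pre' P := by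
  obtain ⟨R, h1, h2⟩ := h
  exact ⟨R, h1, fun g ν π hp' hs => h2 g ν π (hp _ _ _ hp') hs⟩

theorem Ck.or {pre : ∀ g : LGraph Sig, (ℕ → g.V) → List (X × g.V) → Prop}
    {P P' : ∀ g : LGraph Sig, (ℕ → g.V) → Prop} (h : Ck k pre P) (h' : Ck k pre P') :
    Ck k pre (fun g ν => P g ν ∨ P' g ν) := by
  obtain ⟨R, h1, h2⟩ := h
  obtain ⟨R', h1', h2'⟩ := h'
  refine ⟨_, h1.or h1', fun g ν π hp hs => ⟨?_, ?_⟩⟩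
  · rintro c' (h | h)
    · exact ⟨((h2 g ν π hp hs).1 c' h).1, Or.inl ((h2 g ν π hp hs).1 c' h).2⟩
    · exact ⟨((h2' g ν π hp hs).1 c' h).1, Or.inr ((h2' g ν π hp hs).1 c' h).2⟩
  · rintro (h | h)
    · obtain ⟨hs', h⟩ := (h2 g ν π hp hs).2 h
      exact ⟨hs', Or.inl h⟩
    · obtain ⟨hs', h⟩ := (h2' g ν π hp hs).2 h
      exact ⟨hs', Or.inr h⟩

theorem Ck.and {pre : ∀ g : LGraph Sig, (ℕ → g.V) → List (X × g.V) → Prop}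
    {P P' : ∀ g : LGraph Sig, (ℕ → g.V) → Prop} (h : Ck k pre P) (h' : Ck k pre P') :
    Ck k pre (fun g ν => P g ν ∧ P' g ν) := by
  obtain ⟨R, h1, h2⟩ := h
  obtain ⟨R', h1', h2'⟩ := h'
  refine ⟨_, h1.comp h1', fun g ν π hp hs => ⟨?_, ?_⟩⟩
  · rintro c' ⟨⟨d1, d2⟩, h, h'⟩
    obtain ⟨e1, e2⟩ := (h2 g ν π hp hs).1 _ h
    dsimp only at e1
    subst e1
    obtain ⟨e1, e3⟩ := (h2' g ν d2 hp d1).1 _ h'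
    exact ⟨e1, e2, e3⟩
  · rintro ⟨h, h'⟩
    obtain ⟨hs1, h⟩ := (h2 g ν π hp hs).2 h
    obtain ⟨hs2, h'⟩ := (h2' g ν π hp hs1).2 h'
    exact ⟨hs2, _, h, h'⟩

variable [Finite Sig]

/-- Checking a test at the node of a variable. -/
theorem Ck.atVar (i : Fin k) {x : ℕ} (hx : x ∈ S) {P : ∀ g : LGraph Sig, (ℕ → g.V) → Prop}
    {T : RelF (fun g : LGraph Sig => HC k X g)} (hT : Pr T)
    (h1 : ∀ g ν π, Good F U S e g ν π → ∀ hs : Fin k → g.V, hs i = ν x → ∀ c',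
      T g (hs, π) c' → c'.2 = π ∧ P g ν)
    (h2 : ∀ g ν π, Good F U S e g ν π → ∀ hs : Fin k → g.V, hs i = ν x → P g ν →
      ∃ hs', T g (hs, π) (hs', π)) :
    Ck k (Good F U S e) P := by
  refine ⟨_, (Pr.instr (.jump i (e x))).comp hT, fun g ν π hp hs => ⟨?_, fun h => ?_⟩⟩
  · rintro c' ⟨⟨d1, d2⟩, ⟨e1, e2, _⟩, h⟩
    dsimp only at e1 e2
    subst e1
    exact h1 g ν d2 hp d1 ((hp.2.2 x hx _).1 e2) _ h
  · obtain ⟨hs', h⟩ := h2 g ν π hp (Function.update hs i (ν x)) (by simp) h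
    refine ⟨hs', (Function.update hs i (ν x), π), ⟨rfl, ?_, ?_⟩, h⟩
    · simp only [Function.update_self]
      exact (hp.2.2 x hx _).2 rfl
    · intro j hj; simp [hj]

theorem Ck.lab (i : Fin k) {x : ℕ} (hx : x ∈ S) (a : Sig) (b : Bool) :
    Ck k (Good F U S e) (fun g ν => g.nlab (ν x) = a ↔ b = true) := by
  refine Ck.atVar i hx (PrT.test b (.lab i a)) ?_ ?_
  · rintro g ν π hp hs hi c' ⟨rfl, h⟩
    exact ⟨rfl, by simpa only [gTestHolds, hi] using h⟩
  · intro g ν π hp hs hi h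
    exact ⟨hs, rfl, by simpa only [gTestHolds, hi] using h⟩

theorem Ck.eq (i : Fin k) {x y : ℕ} (hx : x ∈ S) (hy : y ∈ S) (b : Bool) :
    Ck k (Good F U S e) (fun g ν => ν x = ν y ↔ b = true) := by
  refine Ck.atVar i hx (PrT.test b (.peb i (e y))) ?_ ?_
  · rintro g ν π hp hs hi c' ⟨rfl, h⟩
    exact ⟨rfl, by simpa only [gTestHolds, hi, hp.2.2 y hy] using h⟩
  · intro g ν π hp hs hi h
    exact ⟨hs, rfl, by simpa only [gTestHolds, hi, hp.2.2 y hy] using h⟩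

theorem Ck.edg (i : Fin k) {x y : ℕ} (hx : x ∈ S) (hy : y ∈ S) (a : Sig) (b : Bool) :
    Ck k (Good F U S e) (fun g ν => g.edge a (ν x) (ν y) ↔ b = true) := by
  have hmv := (Pr.instr (.outmove i a)).thenT
    (PrT.test (Sig := Sig) (X := X) b (.peb i (e y)))
  cases b with
  | true =>
    refine Ck.atVar i hx hmv ?_ ?_
    · rintro g ν π hp hs hi ⟨c1, c2⟩ ⟨⟨h1, h2, h3⟩, h4⟩
      dsimp only at h1 h2 h4
      subst h1
      simp only [gTestHolds, hp.2.2 y hy, iff_true] at h4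
      refine ⟨rfl, ?_⟩
      rw [hi, h4] at h2
      simpa using h2
    · intro g ν π hp hs hi h
      refine ⟨Function.update hs i (ν y), ⟨rfl, ?_, ?_⟩, ?_⟩
      · simpa [hi] using h
      · intro j hj; simp [hj]
      · simp [gTestHolds, hp.2.2 y hy]
  | false =>
    refine Ck.atVar i hx (hmv.or (PrT.test false (.outedge i a))) ?_ ?_
    · rintro g ν π hp hs hi ⟨c1, c2⟩ (⟨⟨h1, h2, h3⟩, h4⟩ | ⟨h1, h2⟩)
      · dsimp only at h1 h2 h4
        subst h1
        simp only [gTestHolds, hp.2.2 y hy, Bool.false_eq_true, iff_false] at h4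
        refine ⟨rfl, ?_⟩
        simp only [Bool.false_eq_true, iff_false]
        intro h
        rw [hi] at h2
        exact h4 (g.out_unique _ _ _ _ h2 h)
      · simp only [Prod.mk.injEq] at h1
        obtain ⟨rfl, rfl⟩ := h1
        simp only [gTestHolds, hi, Bool.false_eq_true, iff_false] at h2
        refine ⟨rfl, ?_⟩
        simp only [Bool.false_eq_true, iff_false]
        exact fun h => h2 ⟨_, h⟩
    · intro g ν π hp hs hi h
      simp only [Bool.false_eq_true, iff_false] at h
      by_cases hv : ∃ v, g.edge a (ν x) v
      · obtain ⟨v, hv⟩ := hv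
        refine ⟨Function.update hs i v, Or.inl ⟨⟨rfl, ?_, ?_⟩, ?_⟩⟩
        · simpa [hi] using hv
        · intro j hj; simp [hj]
        · simp only [gTestHolds, hp.2.2 y hy, Function.update_self, Bool.false_eq_true, iff_false]
          rintro rfl
          exact h hv
      · exact ⟨hs, Or.inr ⟨rfl, by simpa [gTestHolds, hi] using hv⟩⟩

/-- Checking a property of the node at which the head `i` stands. -/
theorem Ck.here (i : Fin k) (x : ℕ) (z : X) (hz : z ∉ U)
    {P : ∀ g : LGraph Sig, (ℕ → g.V) → Prop}
    (h : Ck k (Good F (insert z U) S (Function.update e x z)) P) :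
    ∃ R : RelF (fun g : LGraph Sig => HC k X g), Pr R ∧
      ∀ g ν π, Good F U (S \ {x}) e g ν π → ∀ hs,
      (∀ c', R g (hs, π) c' → c'.2 = π ∧ c'.1 i = hs i ∧ P g (Function.update ν x (hs i))) ∧
      (P g (Function.update ν x (hs i)) → ∃ hs', hs' i = hs i ∧ R g (hs, π) (hs', π)) := by
  obtain ⟨R, hR, hR'⟩ := h
  refine ⟨_, (Pr.instr (.dropPeb i z)).comp (hR.comp ((Pr.instr (.jump i z)).comp
    (Pr.instr (.retrieve z)))), fun g ν π hp hs => ?_⟩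
  have hzπ : ∀ w, (z, w) ∉ π := fun w hw => hz (hp.2.1 _ hw)
  have hg : Good F (insert z U) S (Function.update e x z) g (Function.update ν x (hs i))
      ((z, hs i) :: π) := by
    refine ⟨hp.1, ?_, ?_⟩
    · intro p hm
      rcases List.mem_cons.1 hm with rfl | hm
      · exact Or.inl rfl
      · exact Or.inr (hp.2.1 p hm)
    · intro y hy w
      by_cases hyx : y = x
      · subst hyx
        simp [hzπ]
      · have hne : e y ≠ z := by
          rintro hh
          have : e y ∈ U := hp.mem (x := y) ⟨hy, hyx⟩
          exact hz (hh ▸ this)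
        simp only [Function.update_of_ne hyx, List.mem_cons, Prod.mk.injEq, hne, false_and,
          false_or]
        exact hp.2.2 y ⟨hy, hyx⟩ w
  constructor
  · rintro ⟨c1, c2⟩ ⟨⟨a1, a2⟩, ⟨h1, h2, _⟩, ⟨b1, b2⟩, h3, ⟨d1, d2⟩, ⟨h4, h5, _⟩, h6, w, h7⟩
    dsimp only at h1 h2 h4 h5 h6 h7
    subst h1 h2
    obtain ⟨h8, h9⟩ := (hR' g _ _ hg a1).1 _ h3
    dsimp only at h8
    subst h8
    subst h4 h6
    simp only [List.cons.injEq] at h7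
    refine ⟨h7.2.symm, ?_, h9⟩
    simpa [hzπ] using h5
  · intro hh
    obtain ⟨hs1, h1⟩ := (hR' g _ _ hg hs).2 hh
    refine ⟨Function.update hs1 i (hs i), by simp, (hs, (z, hs i) :: π), ⟨rfl, rfl, hzπ⟩,
      (hs1, (z, hs i) :: π), h1, (Function.update hs1 i (hs i), (z, hs i) :: π),
      ⟨rfl, by simp, fun j hj => by simp [hj]⟩, rfl, _, rfl⟩

theorem Ck.ex (i : Fin k) (x : ℕ) (z : X) (hz : z ∉ U)
    {P : ∀ g : LGraph Sig, (ℕ → g.V) → Prop}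
    (h : Ck k (Good F (insert z U) S (Function.update e x z)) P) :
    Ck k (Good F U (S \ {x}) e) (fun g ν => ∃ u, P g (Function.update ν x u)) := by
  obtain ⟨R, hR, hR'⟩ := Ck.here i x z hz h
  refine ⟨_, (Pr.walk i).comp hR, fun g ν π hp hs => ⟨?_, ?_⟩⟩
  · rintro c' ⟨⟨d1, d2⟩, ⟨e1, _⟩, h⟩
    dsimp only at e1
    subst e1
    obtain ⟨h1, _, h2⟩ := (hR' g ν d2 hp d1).1 _ h
    exact ⟨h1, _, h2⟩
  · rintro ⟨u, hu⟩
    obtain ⟨hs', _, h⟩ := (hR' g ν π hp (Function.update hs i u)).2 (by simpa using hu)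
    exact ⟨hs', (Function.update hs i u, π), ⟨rfl, fun j hj => by simp [hj]⟩, h⟩

theorem Good.updVec {g : LGraph Sig} {ν : ℕ → g.V} {π : List (X × g.V)} (xs : Fin k → ℕ)
    (hxs : Function.Injective xs) (f : Fin k → X) (hf : Function.Injective f) (hU : ∀ i, f i ∉ U)
    (h : Good F U (S \ Set.range xs) e g ν π) (a : Fin k → g.V) :
    Good F (U ∪ Set.range f) S (updVec e xs f) g (updVec ν xs a)
      ((List.finRange k).map (fun i => (f i, a i)) ++ π) := by
  have hext := h.ext ((List.finRange k).map (fun i => (f i, a i))) (Set.range f)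
    (by
      intro p hp
      simp only [List.mem_map] at hp
      obtain ⟨i, _, rfl⟩ := hp
      exact ⟨i, rfl⟩)
    (by rintro _ ⟨i, rfl⟩; exact hU i)
  refine ⟨h.1, hext.2.1, ?_⟩
  intro y hy w
  by_cases hyx : y ∈ Set.range xs
  · obtain ⟨i, rfl⟩ := hyx
    rw [updVec_apply _ _ _ hxs, updVec_apply _ _ _ hxs]
    simp only [List.mem_append, List.mem_map, List.mem_finRange, true_and, Prod.mk.injEq]
    constructor
    · rintro (⟨j, h1, h2⟩ | h1)
      · rw [← h2, hf h1]
      · exact absurd (h.2.1 _ h1) (hU i)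
    · rintro rfl
      exact Or.inl ⟨i, rfl, rfl⟩
  · have hn : ∀ i, xs i ≠ y := fun i hi => hyx ⟨i, hi⟩
    rw [updVec_of_not _ _ _ _ hn, updVec_of_not _ _ _ _ hn]
    exact hext.2.2 y ⟨hy, hyx⟩ w

theorem Ck.tc (xs ys us vs : Fin k → ℕ) (hd : Distinct2 xs ys) (fx fy : Fin k → X)
    (hfx : Function.Injective fx) (hfy : Function.Injective fy) (hxU : ∀ i, fx i ∉ U)
    (hyU : ∀ i, fy i ∉ U) (hxy : ∀ i j, fx i ≠ fy j)
    {P : ∀ g : LGraph Sig, (ℕ → g.V) → Prop}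
    (h : Ck k (Good F ((U ∪ Set.range fx) ∪ Set.range fy) S
      (updVec (updVec e xs fx) ys fy)) P) :
    Ck k (Good F U ((S \ (Set.range xs ∪ Set.range ys)) ∪ Set.range us ∪ Set.range vs) e)
      (fun g ν => ReflTransGen
        (fun a b : Fin k → g.V => P g (updVec (updVec ν xs a) ys b))
        (fun i => ν (us i)) (fun i => ν (vs i))) := by
  obtain ⟨R, hR, hR'⟩ := h
  have hstep := (Pr.dropAll (Sig := Sig) fx hfx).comp (Pr.walkAll.comp
    ((Pr.dropAll fy hfy).comp (hR.comp ((Pr.gotoAll fy).comp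
    (Pr.retr ((List.finRange k).map fy ++ (List.finRange k).map fx))))))
  refine ⟨_, (Pr.gotoAll (fun i => e (us i))).comp (hstep.star.thenT
    (PrT.iall fun i => PrT.test true (.peb i (e (vs i))))), fun g ν π hp => ?_⟩
  have hp' : Good F U (S \ (Set.range xs ∪ Set.range ys)) e g ν π :=
    hp.mono (fun y hy => Or.inl (Or.inl hy))
  have hxπ : ∀ i w, (fx i, w) ∉ π := fun i w hw => hxU i (hp.2.1 _ hw)
  have hg : ∀ a b : Fin k → g.V, Good F ((U ∪ Set.range fx) ∪ Set.range fy) S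
      (NestedPebblesGraphs.updVec (NestedPebblesGraphs.updVec e xs fx) ys fy) g
      (NestedPebblesGraphs.updVec (NestedPebblesGraphs.updVec ν xs a) ys b)
      ((List.finRange k).map (fun i => (fy i, b i)) ++
        ((List.finRange k).map (fun i => (fx i, a i)) ++ π)) := by
    intro a b
    refine Good.updVec ys hd.2.1 fy hfy ?_ (Good.updVec xs hd.1 fx hfx hxU ?_ a) b
    · rintro i (hi | ⟨j, hj⟩)
      · exact hyU i hi
      · exact hxy j i hj
    · refine hp'.mono ?_
      rintro y ⟨⟨h1, h2⟩, h3⟩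
      exact ⟨h1, by rintro (h | h); exacts [h3 h, h2 h]⟩
  have hyπ : ∀ (a : Fin k → g.V) i w,
      (fy i, w) ∉ (List.finRange k).map (fun i => (fx i, a i)) ++ π := by
    intro a i w hw
    simp only [List.mem_append, List.mem_map, List.mem_finRange, true_and, Prod.mk.injEq] at hw
    rcases hw with ⟨j, h1, _⟩ | hw
    · exact hxy _ _ h1
    · exact hyU i (hp.2.1 _ hw)
  have hmem : ∀ (a b : Fin k → g.V) i w,
      (fy i, w) ∈ (List.finRange k).map (fun i => (fy i, b i)) ++
        ((List.finRange k).map (fun i => (fx i, a i)) ++ π) ↔ w = b i := by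
    intro a b i w
    rw [List.mem_append, or_iff_left (hyπ a i w)]
    simp only [List.mem_map, List.mem_finRange, true_and, Prod.mk.injEq]
    constructor
    · rintro ⟨j, h1, rfl⟩; rw [hfy h1]
    · rintro rfl; exact ⟨i, rfl, rfl⟩
  intro hs
  constructor
  · rintro ⟨c1, c2⟩ ⟨⟨d1, d2⟩, ⟨h1, h2⟩, h3, h4⟩
    dsimp only at h1 h2
    subst h1
    have hd1 : d1 = fun i => ν (us i) := by
      funext i
      exact (hp.2.2 (us i) (Or.inl (Or.inr ⟨i, rfl⟩)) _).1 (h2 i)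
    have key : c2 = d2 ∧ ReflTransGen (fun a b : Fin k → g.V =>
        P g (NestedPebblesGraphs.updVec (NestedPebblesGraphs.updVec ν xs a) ys b)) d1 c1 := by
      suffices ∀ c : HC k X g, ReflTransGen _ (d1, d2) c → c.2 = d2 ∧ ReflTransGen (fun a b : Fin k → g.V =>
        P g (NestedPebblesGraphs.updVec (NestedPebblesGraphs.updVec ν xs a) ys b)) d1 c.1 from this _ h3
      intro c hc
      induction hc with
      | refl => exact ⟨rfl, .refl⟩
      | @tail y z _ hh ih =>
        obtain ⟨y1, y2⟩ := y
        obtain ⟨z1, z2⟩ := z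
        obtain ⟨ih1, ih2⟩ := ih
        dsimp only at ih1 ih2
        subst ih1
        obtain ⟨⟨a1, a2⟩, ⟨a3, a4, _⟩, ⟨b1, b2⟩, b3, ⟨m1, m2⟩, ⟨m3, m4, _⟩, ⟨n1, n2⟩, hn,
          ⟨o1, o2⟩, ⟨o3, o4⟩, p1, τ, p2, p3⟩ := hh
        dsimp only at a3 a4 b3 m3 m4 o3 o4 p1 p2
        subst a3 a4 b3 m3 m4
        obtain ⟨q1, q2⟩ := (hR' g _ _ (hg a1 m1) m1).1 _ hn
        dsimp only at q1
        subst q1 o3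
        have hm : z1 = m1 := by
          rw [p1]; funext i
          exact (hmem a1 m1 i _).1 (o4 i)
        subst hm
        refine ⟨?_, ih2.tail q2⟩
        have hl := congrArg List.length p3
        rw [← List.append_assoc] at p2
        refine (List.append_inj_right p2 ?_).symm
        simpa using hl.symm
    obtain ⟨rfl, key⟩ := key
    refine ⟨rfl, ?_⟩
    rw [hd1] at key
    convert key using 1
    funext i
    have := h4 i
    simp only [gTestHolds, iff_true] at this
    exact ((hp.2.2 (vs i) (Or.inr ⟨i, rfl⟩) _).1 this).symm
  · intro hr
    refine ⟨fun i => ν (vs i), (fun i => ν (us i), π), ⟨rfl, fun i =>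
      (hp.2.2 (us i) (Or.inl (Or.inr ⟨i, rfl⟩)) _).2 rfl⟩, ?_, fun i => ?_⟩
    · generalize (fun i => ν (vs i)) = v at hr ⊢
      induction hr with
      | refl => exact .refl
      | @tail a b _ hh ih =>
        refine ih.tail ?_
        obtain ⟨hs', h'⟩ := (hR' g _ _ (hg a b) b).2 hh
        let π1 := (List.finRange k).map (fun i => (fx i, a i)) ++ π
        let π2 := (List.finRange k).map (fun i => (fy i, b i)) ++ π1
        refine ⟨(a, π1), ⟨rfl, rfl, hxπ⟩, (b, π1), rfl, (b, π2), ⟨rfl, rfl, hyπ a⟩, (hs', π2), h',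
          (b, π2), ⟨rfl, fun i => (hmem a b i _).2 rfl⟩, rfl, _, (List.append_assoc _ _ _).symm, ?_⟩
        simp [Function.comp_def]
    · simp only [gTestHolds, iff_true]
      exact (hp.2.2 (vs i) (Or.inr ⟨i, rfl⟩) _).2 rfl

end
end NestedPebblesGraphs

namespace NestedPebblesGraphs

open Relation

variable {Sig : Type}

/-! ### Simulating a guide -/

theorem gInstrStep_func {k : ℕ} (g : LGraph Sig) {Y : Type} (ins : GInstr Sig k Y)
    (hj : ∀ i x, ins ≠ .jump i x) (hs : Fin k → g.V) (π : List (Y × g.V))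
    (hs' : Fin k → g.V) (π' : List (Y × g.V)) (hs'' : Fin k → g.V) (π'' : List (Y × g.V))
    (h1 : gInstrStep g ins hs π hs' π') (h2 : gInstrStep g ins hs π hs'' π'') :
    hs' = hs'' ∧ π' = π'' := by
  cases ins with
  | inmove i a =>
    obtain ⟨rfl, h3, h4⟩ := h1
    obtain ⟨rfl, h5, h6⟩ := h2
    refine ⟨funext fun j => ?_, rfl⟩
    by_cases hji : j = i
    · subst hji; exact g.in_unique _ _ _ _ h3 h5
    · rw [h4 j hji, h6 j hji]
  | outmove i a =>
    obtain ⟨rfl, h3, h4⟩ := h1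
    obtain ⟨rfl, h5, h6⟩ := h2
    refine ⟨funext fun j => ?_, rfl⟩
    by_cases hji : j = i
    · subst hji; exact g.out_unique _ _ _ _ h3 h5
    · rw [h4 j hji, h6 j hji]
  | dropPeb i x =>
    obtain ⟨rfl, rfl, _⟩ := h1
    obtain ⟨rfl, rfl, _⟩ := h2
    exact ⟨rfl, rfl⟩
  | retrieve x =>
    obtain ⟨rfl, w, h3⟩ := h1
    obtain ⟨rfl, w', h4⟩ := h2
    rw [h3] at h4
    simp only [List.cons.injEq] at h4
    exact ⟨rfl, h4.2⟩
  | jump i x => exact absurd rfl (hj i x)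
  | test b τ =>
    obtain ⟨rfl, rfl, _⟩ := h1
    obtain ⟨rfl, rfl, _⟩ := h2
    exact ⟨rfl, rfl⟩

theorem GStep_func {k : ℕ} (A : GWA Sig k) (hd : GDeterministic A) (hj : NoJump A)
    (g : LGraph Sig) (c c' c'' : GConf A g) (h1 : GStep A g c c') (h2 : GStep A g c c'') :
    c' = c'' := by
  obtain ⟨i1, h1, h3⟩ := h1
  obtain ⟨i2, h2, h4⟩ := h2
  have neg : ∀ χ χ' : GInstr Sig k A.X, gNegOf χ χ' → ∀ hs π hs' π' hs'' π'',
      gInstrStep g χ hs π hs' π' → gInstrStep g χ' hs π hs'' π'' → False := by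
    rintro _ _ ⟨b, τ, rfl, rfl⟩ hs π hs' π' hs'' π'' h1 h2
    have h3 := h1.2.2
    have h4 := h2.2.2
    rw [h3] at h4
    cases b <;> simp at h4
  by_cases he : (i1, c'.1) = (i2, c''.1)
  · simp only [Prod.mk.injEq] at he
    obtain ⟨rfl, he⟩ := he
    obtain ⟨h5, h6⟩ := gInstrStep_func g i1 (hj _ _ _ h1) _ _ _ _ _ _ h3 h4
    exact Prod.ext he (Prod.ext h5 h6)
  · rcases hd _ _ _ _ _ h1 h2 he with h | h
    · exact (neg _ _ h _ _ _ _ _ _ h3 h4).elim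
    · exact (neg _ _ h _ _ _ _ _ _ h4 h3).elim

/-- A checked run to a halting configuration checks everything on a search. -/
theorem checked_iff {G : GWA Sig 1} (hd : GDeterministic G) (hj : NoJump G) (g : LGraph Sig)
    (u : g.V) (hs : SearchesFrom G g u) (Q : g.V → Prop) :
    (∃ c, ReflTransGen (fun c c' => Q (c.2.1 0) ∧ GStep G g c c') (G.q0, fun _ => u, []) c ∧
      Q (c.2.1 0) ∧ GHaltingConf G g c) ↔ ∀ v, Q v := by
  obtain ⟨n, cs, h0, hst, hlast, hall⟩ := hs
  constructor
  · rintro ⟨c, hc, hQ, hh⟩ v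
    have key : ∀ m (hm : m < n + 1), ReflTransGen (fun c c' => Q (c.2.1 0) ∧ GStep G g c c')
        (cs ⟨m, hm⟩) c := by
      intro m
      induction m with
      | zero =>
        intro hm
        have : cs ⟨0, hm⟩ = _ := h0
        rw [this]; exact hc
      | succ m ih =>
        intro hm
        have ih := ih (by omega)
        have hs := hst ⟨m, by omega⟩
        rcases ReflTransGen.cases_head ih with h | ⟨d, ⟨_, h1⟩, h2⟩
        · rw [← h] at hh
          exact (hh _ hs).elim
        · have := GStep_func G hd hj g _ _ _ hs h1
          have e : cs ⟨m + 1, hm⟩ = d := this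
          rw [e]; exact h2
    obtain ⟨⟨i, hi⟩, h, rfl⟩ := hall v
    rw [Subsingleton.elim h 0]
    rcases ReflTransGen.cases_head (key i hi) with h | ⟨d, ⟨h1, _⟩, h2⟩
    · rw [h]; exact hQ
    · exact h1
  · intro hQ
    refine ⟨_, ?_, hQ _, hlast⟩
    rw [← h0]
    have key : ∀ m (hm : m < n + 1), ReflTransGen (fun c c' => Q (c.2.1 0) ∧ GStep G g c c')
        (cs 0) (cs ⟨m, hm⟩) := by
      intro m
      induction m with
      | zero => intro hm; exact .refl
      | succ m ih =>
        intro hm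
        exact (ih (by omega)).tail ⟨hQ _, hst ⟨m, by omega⟩⟩
    exact key n (by omega)

section
variable {k : ℕ} {X Y : Type} (i : Fin k) (emb : Y → X)

/-- Translation of tests of the guide. -/
def trT : GTest Sig 1 Y → GTest Sig k X
  | .lab _ a => .lab i a
  | .inedge _ a => .inedge i a
  | .outedge _ a => .outedge i a
  | .peb _ x => .peb i (emb x)

/-- Translation of instructions of the guide. -/
def trI : GInstr Sig 1 Y → GInstr Sig k X
  | .inmove _ a => .inmove i a
  | .outmove _ a => .outmove i a
  | .dropPeb _ x => .dropPeb i (emb x)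
  | .retrieve x => .retrieve (emb x)
  | .jump _ x => .jump i (emb x)
  | .test b τ => .test b (trT i emb τ)

/-- Effect of an instruction on the names on the stack. -/
def lstep : GInstr Sig 1 Y → List Y → List Y → Prop
  | .dropPeb _ x, l, l' => x ∉ l ∧ l' = x :: l
  | .retrieve x, l, l' => l = x :: l'
  | _, l, l' => l' = l

/-- The translated stack. -/
def tstk {V : Type} (πG : List (Y × V)) : List (X × V) := πG.map (fun p => (emb p.1, p.2))

theorem mem_tstk {V : Type} (hemb : Function.Injective emb) {U : Set X} (hU : ∀ y, emb y ∉ U)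
    (πG : List (Y × V)) (π : List (X × V)) (hπ : ∀ p ∈ π, p.1 ∈ U) (y : Y) (w : V) :
    (emb y, w) ∈ tstk emb πG ++ π ↔ (y, w) ∈ πG := by
  simp only [tstk, List.mem_append, List.mem_map, Prod.mk.injEq, Prod.exists]
  constructor
  · rintro (⟨y', w', h1, h2, rfl⟩ | h)
    · rw [← hemb h2]; exact h1
    · exact (hU y (hπ _ h)).elim
  · intro h
    exact Or.inl ⟨y, w, h, rfl, rfl⟩

theorem trT_holds (hemb : Function.Injective emb) {U : Set X} (hU : ∀ y, emb y ∉ U)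
    (g : LGraph Sig) (πG : List (Y × g.V)) (π : List (X × g.V)) (hπ : ∀ p ∈ π, p.1 ∈ U)
    (τ : GTest Sig 1 Y) (hs : Fin k → g.V) (h : Fin 1 → g.V) (hh : ∀ j, h j = hs i) :
    gTestHolds g (trT i emb τ) hs (tstk emb πG ++ π) ↔ gTestHolds g τ h πG := by
  cases τ with
  | lab j a => simp only [trT, gTestHolds, hh]
  | inedge j a => simp only [trT, gTestHolds, hh]
  | outedge j a => simp only [trT, gTestHolds, hh]
  | peb j x => simp only [trT, gTestHolds, hh, mem_tstk emb hemb hU πG π hπ]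

theorem trI_sound (hemb : Function.Injective emb) {U : Set X} (hU : ∀ y, emb y ∉ U)
    (g : LGraph Sig) (πG : List (Y × g.V)) (π : List (X × g.V)) (hπ : ∀ p ∈ π, p.1 ∈ U)
    (ins : GInstr Sig 1 Y) (hs hs' : Fin k → g.V) (π' : List (X × g.V)) (l' : List Y)
    (h1 : gInstrStep g (trI i emb ins) hs (tstk emb πG ++ π) hs' π')
    (h2 : lstep ins (πG.map Prod.fst) l') :
    ∃ πG', π' = tstk emb πG' ++ π ∧ l' = πG'.map Prod.fst ∧
      gInstrStep g ins (fun _ => hs i) πG (fun _ => hs' i) πG' := by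
  have h01 : ∀ (j h : Fin 1), h ≠ j → hs' i = hs i := fun j h hh => (hh (Subsingleton.elim _ _)).elim
  cases ins with
  | inmove j a => exact ⟨πG, h1.1, h2, rfl, h1.2.1, h01 j⟩
  | outmove j a => exact ⟨πG, h1.1, h2, rfl, h1.2.1, h01 j⟩
  | dropPeb j x =>
    obtain ⟨h3, h4, h5⟩ := h1
    obtain ⟨h6, h7⟩ := h2
    refine ⟨(x, hs i) :: πG, by simp [h4, tstk], by simp [h7], by rw [h3], rfl, fun w hw => ?_⟩
    exact h6 (List.mem_map.2 ⟨_, hw, rfl⟩)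
  | retrieve x =>
    obtain ⟨h3, w, h4⟩ := h1
    rcases πG with _ | ⟨⟨y, w'⟩, πG⟩
    · simp [lstep] at h2
    · simp only [tstk, List.map_cons, List.cons_append, List.cons.injEq, Prod.mk.injEq, lstep] at h4 h2
      obtain ⟨rfl, h2⟩ := h2
      exact ⟨πG, h4.2.symm, h2.symm, by rw [h3], w', rfl⟩
  | jump j x =>
    refine ⟨πG, h1.1, h2, rfl, ?_, h01 j⟩
    exact (mem_tstk emb hemb hU πG π hπ _ _).1 h1.2.1
  | test b τ =>
    refine ⟨πG, h1.2.1, h2, by rw [h1.1], rfl, ?_⟩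
    rw [← trT_holds i emb hemb hU g πG π hπ τ hs _ (fun _ => rfl)]
    exact h1.2.2

theorem trI_complete (hemb : Function.Injective emb) {U : Set X} (hU : ∀ y, emb y ∉ U)
    (g : LGraph Sig) (πG πG' : List (Y × g.V)) (π : List (X × g.V)) (hπ : ∀ p ∈ π, p.1 ∈ U)
    (ins : GInstr Sig 1 Y) (hs : Fin k → g.V) (h h' : Fin 1 → g.V) (hh : ∀ j, h j = hs i)
    (h1 : gInstrStep g ins h πG h' πG') :
    ∃ hs', h' 0 = hs' i ∧
      gInstrStep g (trI i emb ins) hs (tstk emb πG ++ π) hs' (tstk emb πG' ++ π) ∧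
      lstep ins (πG.map Prod.fst) (πG'.map Prod.fst) := by
  have h10 : ∀ j : Fin 1, h' j = h' 0 := fun j => by rw [Subsingleton.elim j 0]
  have upd : ∀ v, ∀ j, j ≠ i → Function.update hs i v j = hs j := fun v j hj => by simp [hj]
  cases ins with
  | inmove j a =>
    obtain ⟨rfl, h2, _⟩ := h1
    rw [hh, h10] at h2
    exact ⟨Function.update hs i (h' 0), by simp, ⟨rfl, by simpa using h2, upd _⟩, rfl⟩
  | outmove j a =>
    obtain ⟨rfl, h2, _⟩ := h1
    rw [hh, h10] at h2
    exact ⟨Function.update hs i (h' 0), by simp, ⟨rfl, by simpa using h2, upd _⟩, rfl⟩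
  | dropPeb j x =>
    obtain ⟨rfl, rfl, h2⟩ := h1
    refine ⟨hs, hh 0, ⟨rfl, by simp [tstk, hh], fun w => ?_⟩, ?_, by simp⟩
    · rw [mem_tstk emb hemb hU πG π hπ]; exact h2 w
    · intro hm
      obtain ⟨⟨y, w⟩, hm', rfl⟩ := List.mem_map.1 hm
      exact h2 w hm'
  | retrieve x =>
    obtain ⟨rfl, w, rfl⟩ := h1
    exact ⟨hs, hh 0, ⟨rfl, w, by simp [tstk]⟩, by simp [lstep]⟩
  | jump j x =>
    obtain ⟨rfl, h2, _⟩ := h1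
    rw [h10] at h2
    refine ⟨Function.update hs i (h' 0), by simp, ⟨rfl, ?_, upd _⟩, rfl⟩
    rw [mem_tstk emb hemb hU πG' π hπ]
    simpa using h2
  | test b τ =>
    obtain ⟨rfl, rfl, h2⟩ := h1
    refine ⟨hs, hh 0, ⟨rfl, rfl, ?_⟩, rfl⟩
    rw [trT_holds i emb hemb hU g πG' π hπ τ hs _ hh]
    exact h2

/-- Inapplicability of an instruction of the guide. -/
def napp (ins : GInstr Sig 1 Y) (l : List Y) (g : LGraph Sig) (c : HC k X g) : Prop :=
  match ins with
  | .inmove _ a => ¬ ∃ u, g.edge a u (c.1 i)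
  | .outmove _ a => ¬ ∃ u, g.edge a (c.1 i) u
  | .dropPeb _ x => x ∈ l
  | .retrieve x => l.head? ≠ some x
  | .jump _ x => x ∉ l
  | .test b τ => ¬ (gTestHolds g (trT i emb τ) c.1 c.2 ↔ b = true)

theorem PrT.napp (ins : GInstr Sig 1 Y) (l : List Y) : PrT (napp (Sig := Sig) i emb ins l) := by
  cases ins with
  | inmove j a =>
    exact (PrT.test false (.inedge i a)).congr (by simp [NestedPebblesGraphs.napp, gTestHolds])
  | outmove j a =>
    exact (PrT.test false (.outedge i a)).congr (by simp [NestedPebblesGraphs.napp, gTestHolds])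
  | dropPeb j x => exact PrT.const _
  | retrieve x => exact PrT.const _
  | jump j x => exact PrT.const _
  | test b τ =>
    refine (PrT.test (!b) (trT i emb τ)).congr fun g c => ?_
    simp only [NestedPebblesGraphs.napp]
    cases b <;> simp

theorem napp_iff (hemb : Function.Injective emb) {U : Set X} (hU : ∀ y, emb y ∉ U)
    (g : LGraph Sig) (πG : List (Y × g.V)) (π : List (X × g.V)) (hπ : ∀ p ∈ π, p.1 ∈ U)
    (ins : GInstr Sig 1 Y) (hs : Fin k → g.V) (h : Fin 1 → g.V) (hh : ∀ j, h j = hs i) :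
    napp i emb ins (πG.map Prod.fst) g (hs, tstk emb πG ++ π) ↔
      ¬ ∃ h' πG', gInstrStep g ins h πG h' πG' := by
  have h01 : ∀ (v : g.V) (j h' : Fin 1), h' ≠ j → v = h h' :=
    fun v j h hh => (hh (Subsingleton.elim _ _)).elim
  cases ins with
  | inmove j a =>
    refine not_congr ⟨?_, ?_⟩
    · rintro ⟨u, hu⟩
      exact ⟨fun _ => u, πG, rfl, by rw [hh]; exact hu, h01 _ _⟩
    · rintro ⟨h', πG', _, h2, _⟩
      rw [hh] at h2; exact ⟨_, h2⟩
  | outmove j a =>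
    refine not_congr ⟨?_, ?_⟩
    · rintro ⟨u, hu⟩
      exact ⟨fun _ => u, πG, rfl, by rw [hh]; exact hu, h01 _ _⟩
    · rintro ⟨h', πG', _, h2, _⟩
      rw [hh] at h2; exact ⟨_, h2⟩
  | dropPeb j x =>
    rw [← not_iff_not, not_not]
    constructor
    · intro hx
      exact ⟨h, _, rfl, rfl, fun w hw => hx (List.mem_map.2 ⟨_, hw, rfl⟩)⟩
    · rintro ⟨h', πG', _, _, h2⟩ hx
      obtain ⟨⟨y, w⟩, hm, rfl⟩ := List.mem_map.1 hx
      exact h2 w hm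
  | retrieve x =>
    refine not_congr ⟨?_, ?_⟩
    · intro hx
      rcases πG with _ | ⟨⟨y, w⟩, πG⟩
      · simp at hx
      · simp only [List.map_cons, List.head?_cons, Option.some.injEq] at hx
        subst hx
        exact ⟨h, πG, rfl, w, rfl⟩
    · rintro ⟨h', πG', _, w, rfl⟩
      simp
  | jump j x =>
    refine not_congr ⟨?_, ?_⟩
    · intro hx
      obtain ⟨⟨y, w⟩, hm, rfl⟩ := List.mem_map.1 hx
      exact ⟨fun _ => w, πG, rfl, hm, h01 _ _⟩
    · rintro ⟨h', πG', _, h2, _⟩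
      exact List.mem_map.2 ⟨_, h2, rfl⟩
  | test b τ =>
    refine not_congr ?_
    rw [trT_holds i emb hemb hU g πG π hπ τ hs _ hh]
    constructor
    · intro h2; exact ⟨h, πG, rfl, rfl, h2⟩
    · rintro ⟨_, _, _, _, h2⟩; exact h2

end
end NestedPebblesGraphs

namespace NestedPebblesGraphs

open Relation

variable {Sig : Type}

theorem Ck.all [Finite Sig] {k : ℕ} {X : Type} {F : Set (LGraph Sig)} {U : Set X} {S : Set ℕ}
    {e : ℕ → X} (G : GWA Sig 1) (hd : GDeterministic G) (hj : NoJump G)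
    (hs : ∀ g ∈ F, ∀ u : g.V, SearchesFrom G g u)
    (i : Fin k) (x : ℕ) (z : X) (emb : G.X → X) (hemb : Function.Injective emb)
    (hU : ∀ y, emb y ∉ U) (hz : z ∉ U ∪ Set.range emb)
    {P : ∀ g : LGraph Sig, (ℕ → g.V) → Prop}
    (h : Ck k (Good F (insert z (U ∪ Set.range emb)) S (Function.update e x z)) P) :
    Ck k (Good F U (S \ {x}) e) (fun g ν => ∀ u, P g (Function.update ν x u)) := by
  classical
  have _ := G.finQ
  have _ := G.finX
  obtain ⟨H, hH, hH'⟩ := Ck.here i x z hz h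
  let St := G.Q × {l : List G.X // l.Nodup}
  let T : St → St → RelF (fun g : LGraph Sig => HC k X g) := fun p p' g c c' =>
    ∃ d, H g c d ∧ ∃ ins, ((p.1, ins, p'.1) ∈ G.instr ∧ lstep ins p.2.1 p'.2.1) ∧
      gInstrStep g (trI i emb ins) d.1 d.2 c'.1 c'.2
  have hT : ∀ p p', Pr (T p p') := fun p p' =>
    hH.comp (Pr.iex fun ins => Pr.constAnd _ (Pr.instr (trI i emb ins)))
  let s0 : St := (G.q0, ⟨[], List.nodup_nil⟩)
  have hpath := fun p => kleene Pr Pr.bot (fun _ _ => Pr.or) (fun _ _ => Pr.comp)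
    (fun _ => Pr.star) T hT s0 p
  have hhalt : ∀ p : St, PrT (fun g c => ∀ ins q', (p.1, ins, q') ∈ G.instr →
      napp (X := X) i emb ins p.2.1 g c) := fun p =>
    PrT.iall fun ins => PrT.iall fun q' => PrT.imp _ fun _ => PrT.napp i emb ins p.2.1
  refine ⟨_, Pr.iex fun p : St => (hpath p).comp ((hH.thenT (hhalt p)).comp
    (Pr.retr (p.2.1.map emb))), fun g ν π hp hs0 => ?_⟩
  have hgood : ∀ πG : List (G.X × g.V), Good F (U ∪ Set.range emb) (S \ {x}) e g ν
      (tstk emb πG ++ π) := by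
    intro πG
    refine hp.ext _ _ ?_ ?_
    · intro p hm
      simp only [tstk, List.mem_map] at hm
      obtain ⟨q, _, rfl⟩ := hm
      exact ⟨_, rfl⟩
    · rintro _ ⟨y, rfl⟩; exact hU y
  have hhc : ∀ q (h : Fin 1 → g.V) (πG : List (G.X × g.V)) (hs : Fin k → g.V),
      (∀ j, h j = hs i) → (GHaltingConf G g (q, h, πG) ↔ ∀ ins q', (q, ins, q') ∈ G.instr →
        napp i emb ins (πG.map Prod.fst) g (hs, tstk emb πG ++ π)) := by
    intro q h πG hs hh
    simp only [napp_iff i emb hemb hU g πG π hp.2.1 _ hs h hh]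
    constructor
    · rintro hc ins q' hi ⟨h', πG', hst⟩
      exact hc (q', h', πG') ⟨ins, hi, hst⟩
    · rintro hc ⟨q', h', πG'⟩ ⟨ins, hi, hst⟩
      exact hc ins q' hi ⟨h', πG', hst⟩
  beta_reduce
  rw [← checked_iff hd hj g (hs0 i) (hs g hp.1 _) (fun u => P g (Function.update ν x u))]
  constructor
  · rintro ⟨c1', c2'⟩ ⟨⟨q, l, hl⟩, ⟨c1, c2⟩, hpa, ⟨d1, d2⟩, ⟨hh, hha⟩, h1, τ, h2, h3⟩
    have key : ∀ y : St × HC k X g,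
        ReflTransGen (fun x y : St × HC k X g => T x.1 y.1 g x.2 y.2) (s0, (hs0, π)) y →
        ∃ πG, y.2.2 = tstk emb πG ++ π ∧ y.1.2.1 = πG.map Prod.fst ∧
          ReflTransGen (fun c c' => P g (Function.update ν x (c.2.1 0)) ∧ GStep G g c c')
            (G.q0, fun _ => hs0 i, []) (y.1.1, fun _ => y.2.1 i, πG) := by
      intro y hy
      induction hy with
      | refl => exact ⟨[], rfl, rfl, .refl⟩
      | @tail y w _ hst ih =>
        obtain ⟨⟨q, l, hl⟩, a1, a2⟩ := y
        obtain ⟨⟨q', l', hl'⟩, b1, b2⟩ := w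
        obtain ⟨πG, e1, e2, e3⟩ := ih
        obtain ⟨⟨d1, d2⟩, hh, ins, ⟨hi, hls⟩, hst⟩ := hst
        dsimp only at e1 e2 e3 hh hi hls hst ⊢
        subst e1 e2
        obtain ⟨f1, f2, f3⟩ := (hH' g ν _ (hgood πG) a1).1 _ hh
        dsimp only at f1 f2
        subst f1
        obtain ⟨πG', j1, j2, j3⟩ := trI_sound i emb hemb hU g πG π hp.2.1 ins _ _ _ _ hst hls
        refine ⟨πG', j1, j2, e3.tail ⟨f3, ins, hi, ?_⟩⟩
        rw [f2] at j3
        exact j3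
    obtain ⟨πG, e1, e2, e3⟩ := key _ hpa
    dsimp only at e1 e2 e3 hha h1 h2 h3
    subst e1 e2
    obtain ⟨f1, f2, f3⟩ := (hH' g ν _ (hgood πG) c1).1 _ hh
    dsimp only at f1 f2
    subst f1
    constructor
    · refine (List.append_inj_right h2 ?_).symm
      have := congrArg List.length h3
      simpa [tstk] using this.symm
    · refine ⟨_, e3, f3, ?_⟩
      exact (hhc q _ πG d1 (fun _ => f2.symm)).2 hha
  · rintro ⟨⟨q, h, πG⟩, hr, hq, hc⟩
    have key : ∀ y : GConf G g,
        ReflTransGen (fun c c' => P g (Function.update ν x (c.2.1 0)) ∧ GStep G g c c')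
            (G.q0, fun _ => hs0 i, []) y →
        ∃ (hl : (y.2.2.map Prod.fst).Nodup) (hs : Fin k → g.V), y.2.1 0 = hs i ∧
        ReflTransGen (fun x y : St × HC k X g => T x.1 y.1 g x.2 y.2) (s0, (hs0, π))
          ((y.1, ⟨_, hl⟩), (hs, tstk emb y.2.2 ++ π)) := by
      intro y hy
      induction hy with
      | refl => exact ⟨List.nodup_nil, hs0, rfl, .refl⟩
      | @tail y w _ hst ih =>
        obtain ⟨q, h, πG⟩ := y
        obtain ⟨q', h', πG'⟩ := w
        obtain ⟨hl, hs1, e1, e2⟩ := ih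
        obtain ⟨hP, ins, hi, hst⟩ := hst
        dsimp only at hl e1 e2 hP hi hst ⊢
        rw [e1] at hP
        obtain ⟨hs2, f1, f2⟩ := (hH' g ν _ (hgood πG) hs1).2 hP
        have hh : ∀ j, h j = hs2 i := fun j => by rw [Subsingleton.elim j 0, e1, f1]
        obtain ⟨hs3, j1, j2, j3⟩ := trI_complete i emb hemb hU g πG πG' π hp.2.1 ins hs2 h h' hh hst
        have hl' : (πG'.map Prod.fst).Nodup := by
          cases ins with
          | dropPeb j x => rw [j3.2]; exact List.nodup_cons.2 ⟨j3.1, hl⟩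
          | retrieve x =>
            have j3 : _ = x :: _ := j3
            rw [j3] at hl
            exact (List.nodup_cons.1 hl).2
          | inmove j a => rw [show _ = _ from j3]; exact hl
          | outmove j a => rw [show _ = _ from j3]; exact hl
          | jump j a => rw [show _ = _ from j3]; exact hl
          | test j a => rw [show _ = _ from j3]; exact hl
        exact ⟨hl', hs3, j1, e2.tail ⟨_, f2, ins, ⟨hi, j3⟩, j2⟩⟩
    obtain ⟨hl, hs1, e1, e2⟩ := key _ hr
    dsimp only at hl e1 e2 hq
    rw [e1] at hq
    obtain ⟨hs2, f1, f2⟩ := (hH' g ν _ (hgood πG) hs1).2 hq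
    have hh : ∀ j, h j = hs2 i := fun j => by rw [Subsingleton.elim j 0, e1, f1]
    refine ⟨hs2, (q, ⟨_, hl⟩), (hs1, tstk emb πG ++ π), e2, (hs2, tstk emb πG ++ π),
      ⟨f2, (hhc q h πG hs2 hh).1 hc⟩, rfl, tstk emb πG, rfl, ?_⟩
    simp [tstk, Function.comp_def]

/-- Every formula can be checked. -/
theorem Ck.form [Finite Sig] {k : ℕ} (i : Fin k) {F : Set (LGraph Sig)}
    (G : GWA Sig 1) (hd : GDeterministic G) (hj : NoJump G)
    (hs : ∀ g ∈ F, ∀ u : g.V, SearchesFrom G g u) (φ : GForm Sig k) :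
    GWF φ → ∀ b, GPosTC b φ → ∃ (N : Type) (_ : Finite N), ∀ (X : Type) (f : N → X),
      Function.Injective f → ∀ (U : Set X), (∀ n, f n ∉ U) → ∀ e : ℕ → X,
      Ck k (Good F U (gfree φ) e) (fun g ν => GSat g φ ν ↔ b = true) := by
  have _ := G.finX
  -- existential and universal quantification
  have qe : ∀ (x : ℕ) (S : Set ℕ) (P : ∀ g : LGraph Sig, (ℕ → g.V) → Prop),
      (∃ (N : Type) (_ : Finite N), ∀ (X : Type) (f : N → X),
        Function.Injective f → ∀ (U : Set X), (∀ n, f n ∉ U) → ∀ e : ℕ → X,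
        Ck k (Good F U S e) P) →
      ∃ (N : Type) (_ : Finite N), ∀ (X : Type) (f : N → X),
        Function.Injective f → ∀ (U : Set X), (∀ n, f n ∉ U) → ∀ e : ℕ → X,
        Ck k (Good F U (S \ {x}) e) (fun g ν => ∃ u, P g (Function.update ν x u)) := by
    rintro x S P ⟨N, _, hN⟩
    refine ⟨N ⊕ Unit, inferInstance, fun X f hf U hU e => ?_⟩
    refine Ck.ex i x (f (.inr ())) (hU _) (hN X (f ∘ Sum.inl) (hf.comp Sum.inl_injective) _ ?_ _)
    rintro n (h | h)
    · exact absurd (hf h) (by simp)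
    · exact hU _ h
  have qa : ∀ (x : ℕ) (S : Set ℕ) (P : ∀ g : LGraph Sig, (ℕ → g.V) → Prop),
      (∃ (N : Type) (_ : Finite N), ∀ (X : Type) (f : N → X),
        Function.Injective f → ∀ (U : Set X), (∀ n, f n ∉ U) → ∀ e : ℕ → X,
        Ck k (Good F U S e) P) →
      ∃ (N : Type) (_ : Finite N), ∀ (X : Type) (f : N → X),
        Function.Injective f → ∀ (U : Set X), (∀ n, f n ∉ U) → ∀ e : ℕ → X,
        Ck k (Good F U (S \ {x}) e) (fun g ν => ∀ u, P g (Function.update ν x u)) := by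
    rintro x S P ⟨N, _, hN⟩
    refine ⟨N ⊕ Unit ⊕ G.X, inferInstance, fun X f hf U hU e => ?_⟩
    refine Ck.all G hd hj hs i x (f (.inr (.inl ()))) (fun y => f (.inr (.inr y))) ?_ ?_ ?_
      (hN X (f ∘ Sum.inl) (hf.comp Sum.inl_injective) _ ?_ _)
    · intro y y' h
      simpa using hf h
    · intro y; exact hU _
    · rintro (h | ⟨y, h⟩)
      · exact hU _ h
      · exact absurd (hf h) (by simp)
    · rintro n (h | h | ⟨y, h⟩)
      · exact absurd (hf h) (by simp)
      · exact hU _ h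
      · exact absurd (hf h) (by simp)
  induction φ with
  | lab a x =>
    intro _ b _
    exact ⟨Empty, inferInstance, fun X f _ U _ e => 
      Ck.lab (S := gfree (GForm.lab a x)) (x := x) i (Set.mem_singleton x) a b⟩
  | edg a x y =>
    intro _ b _
    exact ⟨Empty, inferInstance, fun X f _ U _ e => Ck.edg i (Or.inl rfl) (Or.inr rfl) a b⟩
  | eq x y =>
    intro _ b _
    exact ⟨Empty, inferInstance, fun X f _ U _ e => Ck.eq i (Or.inl rfl) (Or.inr rfl) b⟩
  | not φ ih =>
    intro hw b hb
    obtain ⟨N, hN, h⟩ := ih hw (!b) hb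
    refine ⟨N, hN, fun X f hf U hU e => (h X f hf U hU e).congr fun g ν => ?_⟩
    simp only [GSat]
    cases b <;> simp
  | and φ ψ ih1 ih2 =>
    intro hw b hb
    obtain ⟨N1, _, h1⟩ := ih1 hw.1 b hb.1
    obtain ⟨N2, _, h2⟩ := ih2 hw.2 b hb.2
    refine ⟨N1 ⊕ N2, inferInstance, fun X f hf U hU e => ?_⟩
    have h1 := (h1 X (f ∘ Sum.inl) (hf.comp Sum.inl_injective) U (fun n => hU _) e).pre
      (pre' := Good F U (gfree (GForm.and φ ψ)) e) (fun g ν π h => h.mono (fun x hx => Or.inl hx))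
    have h2 := (h2 X (f ∘ Sum.inr) (hf.comp Sum.inr_injective) U (fun n => hU _) e).pre
      (pre' := Good F U (gfree (GForm.and φ ψ)) e) (fun g ν π h => h.mono (fun x hx => Or.inr hx))
    cases b with
    | true => exact (h1.and h2).congr fun g ν => by simp [GSat]
    | false => exact (h1.or h2).congr fun g ν => by simp only [GSat]; simp; tauto
  | or φ ψ ih1 ih2 =>
    intro hw b hb
    obtain ⟨N1, _, h1⟩ := ih1 hw.1 b hb.1
    obtain ⟨N2, _, h2⟩ := ih2 hw.2 b hb.2
    refine ⟨N1 ⊕ N2, inferInstance, fun X f hf U hU e => ?_⟩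
    have h1 := (h1 X (f ∘ Sum.inl) (hf.comp Sum.inl_injective) U (fun n => hU _) e).pre
      (pre' := Good F U (gfree (GForm.or φ ψ)) e) (fun g ν π h => h.mono (fun x hx => Or.inl hx))
    have h2 := (h2 X (f ∘ Sum.inr) (hf.comp Sum.inr_injective) U (fun n => hU _) e).pre
      (pre' := Good F U (gfree (GForm.or φ ψ)) e) (fun g ν π h => h.mono (fun x hx => Or.inr hx))
    cases b with
    | true => exact (h1.or h2).congr fun g ν => by simp [GSat]
    | false => exact (h1.and h2).congr fun g ν => by simp [GSat]
  | ex x φ ih =>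
    intro hw b hb
    cases b with
    | true =>
      obtain ⟨N, hN, h⟩ := qe x _ _ (ih hw true hb)
      exact ⟨N, hN, fun X f hf U hU e => (h X f hf U hU e).congr fun g ν => by simp [GSat]⟩
    | false =>
      obtain ⟨N, hN, h⟩ := qa x _ _ (ih hw false hb)
      exact ⟨N, hN, fun X f hf U hU e => (h X f hf U hU e).congr fun g ν => by simp [GSat]⟩
  | all x φ ih =>
    intro hw b hb
    cases b with
    | true =>
      obtain ⟨N, hN, h⟩ := qa x _ _ (ih hw true hb)
      exact ⟨N, hN, fun X f hf U hU e => (h X f hf U hU e).congr fun g ν => by simp [GSat]⟩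
    | false =>
      obtain ⟨N, hN, h⟩ := qe x _ _ (ih hw false hb)
      exact ⟨N, hN, fun X f hf U hU e => (h X f hf U hU e).congr fun g ν => by simp [GSat]⟩
  | tc xs ys φ us vs ih =>
    intro hw b hb
    obtain ⟨rfl, hb⟩ := hb
    obtain ⟨hd2, _, hw⟩ := hw
    obtain ⟨N, _, h⟩ := ih hw true hb
    refine ⟨N ⊕ Fin k ⊕ Fin k, inferInstance, fun X f hf U hU e => ?_⟩
    have := Ck.tc (F := F) (U := U) (e := e) (S := gfree φ) xs ys us vs hd2
      (fun i => f (.inr (.inl i))) (fun i => f (.inr (.inr i)))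
      (fun a b h => by simpa using hf h) (fun a b h => by simpa using hf h)
      (fun i => hU _) (fun i => hU _) (fun a b h => absurd (hf h) (by simp))
      (h X (f ∘ Sum.inl) (hf.comp Sum.inl_injective) _ (by
        rintro n ((h | ⟨y, h⟩) | ⟨y, h⟩)
        · exact hU _ h
        · exact absurd (hf h) (by simp)
        · exact absurd (hf h) (by simp)) _)
    exact this.congr fun g ν => by simp [GSat]

theorem FOposTCg_subset (Sig : Type) [Fintype Sig] (F : Set (LGraph Sig)) (hF : Searchable Sig F)
    (k : ℕ) (hk : 1 ≤ k) : FOposTCg Sig F k ⊆ NPTWAg Sig F k := by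
  classical
  rintro L ⟨φ, hw, hp, hf, rfl⟩
  obtain ⟨G, hd, hj, hs⟩ := hF
  let i : Fin k := ⟨0, hk⟩
  obtain ⟨N, _, hN⟩ := Ck.form i G hd hj hs φ hw true hp
  obtain ⟨R, hR, hR'⟩ := hN (Option N) some (Option.some_injective N) ∅ (by simp) (fun _ => none)
  rw [hf] at hR'
  have hT : Pr (fun (g : LGraph Sig) (c c' : HC k (Option N) g) => ∃ d, d.2 = c.2 ∧ R g d c') :=
    Pr.walkAll.comp hR
  obtain ⟨Q, _, T, s, t, ht, hre⟩ := IsProg.realised _ _ hT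
  let I : Set (Q × GInstr Sig k (Option N) × Q) :=
    {x | (∃ h, (x.1, some (⟨x.2.1, h⟩ : NJIns Sig k (Option N)), x.2.2) ∈ T) ∨
      ((x.1, none, x.2.2) ∈ T ∧ ∃ a, x.2.1 = .test true (.lab i a))}
  let A : GWA Sig k :=
    { Q := Q, finQ := Fintype.ofFinite Q, X := Option N, finX := Fintype.ofFinite _, q0 := s,
      acc := {t}, instr := I, instrFin := Set.toFinite I }
  have hstep : ∀ (g : LGraph Sig) (c c' : GConf A g),
      GStep A g c c' ↔ fStep (gsem (Sig := Sig) (k := k) (X := Option N)) T g c c' := by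
    rintro g ⟨q, h, π⟩ ⟨q', h', π'⟩
    constructor
    · rintro ⟨ins, (⟨hn, h1⟩ | ⟨h1, a, h3⟩), h2⟩
      · exact ⟨_, h1, h2⟩
      · dsimp only at h1 h2 h3
        subst h3
        exact ⟨none, h1, Prod.ext h2.1.symm h2.2.1.symm⟩
    · rintro ⟨o, h1, h2⟩
      cases o with
      | none =>
        have h2 : (h, π) = (h', π') := h2
        simp only [Prod.mk.injEq] at h2
        obtain ⟨rfl, rfl⟩ := h2
        exact ⟨.test true (.lab i (g.nlab (h i))), Or.inr ⟨h1, _, rfl⟩, rfl, rfl, by simp [gTestHolds]⟩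
      | some ins => exact ⟨ins.1, Or.inl ⟨ins.2, h1⟩, h2⟩
  have hstep' : ∀ g : LGraph Sig, GStep A g = fStep (gsem (Sig := Sig) (k := k) (X := Option N)) T g :=
    fun g => by funext c c'; exact propext (hstep g c c')
  have hacc : ∀ (g : LGraph Sig) (u : g.V), AccFrom A g u ↔ ∃ hs hs', R g (hs, []) (hs', []) := by
    intro g u
    constructor
    · rintro ⟨q, hs', hq, hr, _⟩
      have hq : q = t := hq
      rw [hq] at hr
      rw [hstep'] at hr
      obtain ⟨⟨d1, d2⟩, h1, h2⟩ := (hre g (fun _ => u, []) (hs', [])).2 hr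
      dsimp only at h1
      subst h1
      exact ⟨d1, hs', h2⟩
    · rintro ⟨hs, hs', h⟩
      refine ⟨t, hs', rfl, ?_, ?_⟩
      · rw [hstep']
        exact (hre g (fun _ => u, []) (hs', [])).1 ⟨(hs, []), rfl, h⟩
      · intro c' hc
        rw [hstep] at hc
        obtain ⟨o, h1, _⟩ := hc
        exact ht _ _ h1
  refine ⟨A, ?_, ?_, ?_⟩
  · rintro p χ q (⟨hn, _⟩ | ⟨_, a, h3⟩) j x
    · exact hn j x
    · dsimp only at h3
      rw [h3]; simp
  · intro g u1 u2
    rw [hacc, hacc]; exact fun h => h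
  · ext g
    refine and_congr_right fun hg => ?_
    have hgd : ∀ ν : ℕ → g.V, Good F (∅ : Set (Option N)) ∅ (fun _ => none) g ν [] := by
      intro ν
      refine ⟨hg, by simp, by simp⟩
    simp only [GAccepts, hacc]
    constructor
    · intro h u
      obtain ⟨hs', h'⟩ := (hR' g (fun _ => u) [] (hgd _) (fun _ => u)).2 (by simpa using h _)
      exact ⟨_, hs', h'⟩
    · intro h ν
      obtain ⟨hs1, hs', h'⟩ := h g.neV.some
      simpa using ((hR' g ν [] (hgd _) hs1).1 _ h').2

end NestedPebblesGraphs

namespace NestedPebblesGraphs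

/-- For every searchable family of graphs and every `k ≥ 1`,
`NPTWA^k = FO+posTC^k`. -/
theorem NPTWAg_eq_FOposTCg_of_searchable (Sig : Type) [Fintype Sig]
    (F : Set (LGraph Sig)) (hF : Searchable Sig F) (k : ℕ) (hk : 1 ≤ k) :
    NPTWAg Sig F k = FOposTCg Sig F k := by
  exact Set.Subset.antisymm (NPTWAg_subset Sig F k) (FOposTCg_subset Sig F hF k hk)

end NestedPebblesGraphs
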